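/- arXiv:math/0508632 — 3 statements merged into one kernel-verified Lean document; each statement's English description precedes it below -/
import Mathlib

section
/- Let k ≥ 100, j ∈ [0,k] be integers and let f : ℝ² → ℂ be a Schwartz function supported in I_k × ℝ. Then ‖F⁻¹[η_{≤j}(τ-ω(ξ)) f(ξ,τ)]‖_{L¹ₓL²ₜ} ≤ C ‖F⁻¹(f)‖_{L¹ₓL²ₜ}, where η_{≤j} is a smooth cutoff to |τ-ω(ξ)| ≲ 2^j, ω(ξ) = -ξ|ξ|, and C is independent of k, j, f. -/
open MeasureTheory

noncomputable section

/-- Benjamin–Ono dispersion relation. -/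
def ω (ξ : ℝ) : ℝ := -ξ * |ξ|

/-- 1D Fourier transform (analyst's convention, kernel `e^{-ixξ}`). -/
def F1 (f : ℝ → ℂ) (ξ : ℝ) : ℂ :=
  ∫ x : ℝ, Complex.exp (-Complex.I * ((x * ξ : ℝ) : ℂ)) * f x

/-- 1D inverse Fourier transform. -/
def F1inv (f : ℝ → ℂ) (x : ℝ) : ℂ :=
  (((2 * Real.pi : ℝ)⁻¹ : ℝ) : ℂ) *
    ∫ ξ : ℝ, Complex.exp (Complex.I * ((x * ξ : ℝ) : ℂ)) * f ξ

/-- 2D (space-time) Fourier transform. -/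
def F2 (f : ℝ × ℝ → ℂ) (q : ℝ × ℝ) : ℂ :=
  ∫ p : ℝ × ℝ, Complex.exp (-Complex.I * ((p.1 * q.1 + p.2 * q.2 : ℝ) : ℂ)) * f p

/-- 2D inverse (space-time) Fourier transform. -/
def F2inv (f : ℝ × ℝ → ℂ) (p : ℝ × ℝ) : ℂ :=
  ((((2 * Real.pi) ^ 2 : ℝ)⁻¹ : ℝ) : ℂ) *
    ∫ q : ℝ × ℝ, Complex.exp (Complex.I * ((p.1 * q.1 + p.2 * q.2 : ℝ) : ℂ)) * f q

/-- Mixed norm `L^p_x L^q_t` of `u = u x t`. -/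
def MixedNorm (p q : ENNReal) (u : ℝ → ℝ → ℂ) : ℝ :=
  (eLpNorm (fun x => (eLpNorm (u x) q volume).toReal) p volume).toReal

/-- Dyadic frequency annulus `I_k`. -/
def Idy (k : ℤ) : Set ℝ := {ξ : ℝ | (2 : ℝ) ^ (k - 1) ≤ |ξ| ∧ |ξ| ≤ (2 : ℝ) ^ (k + 1)}

/-- The smooth dyadic bump `χ_l` built from `η₀`. -/
def chi (η₀ : ℝ → ℝ) (l : ℤ) (ξ : ℝ) : ℝ := η₀ (ξ / 2 ^ l) - η₀ (ξ / 2 ^ (l - 1))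

open scoped FourierTransform ENNReal SchwartzMap

theorem plancherel_ae (h : ℝ → ℂ) (h1 : Integrable h) (h2 : MemLp h 2) :
    (𝓕 (h2.toLp h) : Lp ℂ 2 (volume : Measure ℝ)) =ᵐ[volume] 𝓕 h := by
  have hc : Continuous (𝓕 h) := VectorFourier.fourierIntegral_continuous Real.continuous_fourierChar (L := innerₗ ℝ) (by exact continuous_inner) h1
  apply ae_eq_of_integral_contDiff_smul_eq
  · exact (Lp.memLp _).locallyIntegrable (by norm_num)
  · exact hc.locallyIntegrable
  intro g hg hgc
  have hg' : ContDiff ℝ (⊤ : ℕ∞) (fun x => (g x : ℂ)) := Complex.ofRealCLM.contDiff.comp hg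
  have hgc' : HasCompactSupport (fun x => (g x : ℂ)) := hgc.comp_left (g := fun r : ℝ => (r : ℂ)) (by simp)
  let φ : 𝓢(ℝ, ℂ) := hgc'.toSchwartzMap hg'
  have hφ : ∀ x, φ x = (g x : ℂ) := fun x => rfl
  have key := congrArg (fun T => T φ) (MeasureTheory.Lp.fourier_toTemperedDistribution_eq (h2.toLp h))
  simp only [TemperedDistribution.fourier_apply, Lp.toTemperedDistribution_apply] at key
  have e1 : ∀ x (z : ℂ), g x • z = φ x • z := by
    intro x z; rw [hφ]; simp
  simp_rw [e1]
  rw [← key]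
  have e2 : ∫ x, (𝓕 φ) x • (h2.toLp h) x = ∫ x, (𝓕 φ) x • h x := by
    apply integral_congr_ae
    filter_upwards [h2.coeFn_toLp] with x hx
    rw [hx]
  rw [e2]
  have := VectorFourier.integral_fourierIntegral_smul_eq_flip (L := innerₗ ℝ) (μ := volume) (ν := volume)
    Real.continuous_fourierChar (by exact continuous_inner) φ.integrable h1
  simpa using! this

theorem plancherel_le (h : ℝ → ℂ) (h1 : Integrable h) :
    eLpNorm (𝓕 h) 2 volume ≤ eLpNorm h 2 volume := by
  by_cases h2 : MemLp h 2
  · rw [← eLpNorm_congr_ae (plancherel_ae h h1 h2)]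
    have := MeasureTheory.Lp.norm_fourier_eq (h2.toLp h)
    rw [← eLpNorm_congr_ae h2.coeFn_toLp]
    rw [Lp.norm_def, Lp.norm_def] at this
    rw [ENNReal.toReal_eq_toReal_iff' (Lp.eLpNorm_ne_top _) (Lp.eLpNorm_ne_top _)] at this
    exact this.le
  · have : eLpNorm h 2 volume = ⊤ := by
      by_contra hh
      exact h2 ⟨h1.1, lt_top_iff_ne_top.2 hh⟩
    rw [this]; exact le_top

theorem lint_comp_mul (g : ℝ → ℝ≥0∞) (a : ℝ) (ha : a ≠ 0) :
    ∫⁻ x, g (a * x) = ENNReal.ofReal |a⁻¹| * ∫⁻ x, g x := by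
  have := Real.map_volume_mul_left ha
  have e : MeasurableEmbedding (fun x : ℝ => a * x) := (Homeomorph.mulLeft₀ a ha).measurableEmbedding
  rw [← e.lintegral_map g, this, lintegral_smul_measure, smul_eq_mul]

theorem plancherel_exp (s : ℝ) (hs : s ^ 2 = 1) (h : ℝ → ℂ) (h1 : Integrable h) :
    ∫⁻ τ : ℝ, ‖∫ t : ℝ, Complex.exp (Complex.I * ((s * (t * τ) : ℝ) : ℂ)) * h t‖ₑ ^ 2 ≤
      ENNReal.ofReal (2 * Real.pi) * ∫⁻ t, ‖h t‖ₑ ^ 2 := by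
  have hp := Real.pi_pos
  have hs0 : s ≠ 0 := by rintro rfl; norm_num at hs
  have e : ∀ τ : ℝ, ∫ t : ℝ, Complex.exp (Complex.I * ((s * (t * τ) : ℝ) : ℂ)) * h t
      = 𝓕 h ((-s / (2 * Real.pi)) * τ) := by
    intro τ
    rw [Real.fourier_real_eq_integral_exp_smul]
    congr 1; ext t
    rw [smul_eq_mul]
    congr 2
    push_cast
    have : (Real.pi : ℂ) ≠ 0 := by exact_mod_cast hp.ne'
    field_simp
  simp_rw [e]
  rw [lint_comp_mul (fun y => ‖𝓕 h y‖ₑ ^ 2) _ (div_ne_zero (neg_ne_zero.2 hs0) (by positivity))]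
  have hs1 : |s| = 1 := by
    have : |s| ^ 2 = 1 := by rw [sq_abs, hs]
    nlinarith [abs_nonneg s]
  have : |(-s / (2 * Real.pi))⁻¹| = 2 * Real.pi := by
    rw [abs_inv, abs_div, abs_neg, hs1, abs_of_pos (by positivity)]; simp
  rw [this]
  refine mul_le_mul_right ?_ _
  have := plancherel_le h h1
  rw [eLpNorm_eq_lintegral_rpow_enorm_toReal (by norm_num) (by norm_num),
    eLpNorm_eq_lintegral_rpow_enorm_toReal (by norm_num) (by norm_num)] at this
  have := (ENNReal.rpow_le_rpow_iff (by norm_num)).1 this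
  simpa using this

theorem deriv_zero_outside {m m1 : ℝ → ℂ} {a b : ℝ} (hs : ∀ x, x ∉ Set.Icc a b → m x = 0)
    (h1 : ∀ x, HasDerivAt m (m1 x) x) (x : ℝ) (hx : x ∉ Set.Icc a b) : m1 x = 0 := by
  have : m =ᶠ[nhds x] fun _ => 0 := by
    filter_upwards [isClosed_Icc.isOpen_compl.mem_nhds hx] with y hy using hs y hy
  exact (h1 x).unique ((hasDerivAt_const x (0 : ℂ)).congr_of_eventuallyEq this)

theorem integrable_outside {m : ℝ → ℂ} {a b : ℝ} (hs : ∀ x, x ∉ Set.Icc a b → m x = 0)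
    (hc : Continuous m) : Integrable m :=
  hc.integrable_of_hasCompactSupport (HasCompactSupport.intro isCompact_Icc hs)

theorem norm_fourier_le_outside {m : ℝ → ℂ} {c R P : ℝ} (hR : 0 ≤ R)
    (hs : ∀ x, x ∉ Set.Icc (c - R) (c + R) → m x = 0)
    (hP : ∀ x, ‖m x‖ ≤ P) (w : ℝ) : ‖𝓕 m w‖ ≤ 2 * R * P := by
  rw [Real.fourier_real_eq]
  rw [← setIntegral_eq_integral_of_forall_compl_eq_zero (s := Set.Icc (c - R) (c + R))]
  · refine (norm_setIntegral_le_of_norm_le_const (C := P) ?_ ?_).trans ?_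
    · simp
    · intro x _
      simpa using hP x
    · rw [Real.volume_real_Icc_of_le (by linarith)]
      apply le_of_eq; ring
  · intro x hx
    rw [hs x hx]; simp

theorem exp_integral_eq_fourier (m : ℝ → ℂ) (y : ℝ) :
    ∫ ξ : ℝ, Complex.exp (Complex.I * ((y * ξ : ℝ) : ℂ)) * m ξ = 𝓕 m (-y / (2 * Real.pi)) := by
  rw [Real.fourier_real_eq_integral_exp_smul]
  congr 1; ext t
  rw [smul_eq_mul]
  congr 2
  push_cast
  have : (Real.pi : ℂ) ≠ 0 := by exact_mod_cast Real.pi_pos.ne'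
  field_simp

theorem osc_bound {m m1 m2 : ℝ → ℂ} {c R P Q : ℝ} (hR : 0 ≤ R)
    (hs : ∀ x, x ∉ Set.Icc (c - R) (c + R) → m x = 0)
    (h1 : ∀ x, HasDerivAt m (m1 x) x) (h2 : ∀ x, HasDerivAt m1 (m2 x) x) (hc : Continuous m2)
    (hP : ∀ x, ‖m x‖ ≤ P) (hQ : ∀ x, ‖m2 x‖ ≤ Q) (y : ℝ) :
    ‖∫ ξ : ℝ, Complex.exp (Complex.I * ((y * ξ : ℝ) : ℂ)) * m ξ‖ ≤ 2 * R * P ∧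
    y ^ 2 * ‖∫ ξ : ℝ, Complex.exp (Complex.I * ((y * ξ : ℝ) : ℂ)) * m ξ‖ ≤ 2 * R * Q := by
  rw [exp_integral_eq_fourier]
  refine ⟨norm_fourier_le_outside hR hs hP _, ?_⟩
  have hs1 := deriv_zero_outside hs h1
  have hs2 := deriv_zero_outside hs1 h2
  have d0 : Differentiable ℝ m := fun x => (h1 x).differentiableAt
  have d1 : Differentiable ℝ m1 := fun x => (h2 x).differentiableAt
  have e1 : deriv m = m1 := funext fun x => (h1 x).deriv
  have e2 : deriv m1 = m2 := funext fun x => (h2 x).deriv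
  have f1 := Real.fourier_deriv (integrable_outside hs d0.continuous) d0
    (by rw [e1]; exact integrable_outside hs1 d1.continuous)
  have f2 := Real.fourier_deriv (integrable_outside hs1 d1.continuous) d1
    (by rw [e2]; exact integrable_outside hs2 hc)
  rw [e1] at f1
  rw [e2, f1] at f2
  have := norm_fourier_le_outside hR hs2 hQ (-y / (2 * Real.pi))
  rw [f2] at this
  refine le_trans (le_of_eq ?_) this
  simp only [smul_eq_mul, norm_mul, ← mul_assoc]
  congr 1
  have hp := Real.pi_pos
  simp [abs_of_pos hp]
  field_simp
  rw [sq_abs]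

theorem exists_bump : ∃ b : ℝ → ℝ, ContDiff ℝ (⊤ : ℕ∞) b ∧ (∀ x, b x ∈ Set.Icc (0 : ℝ) 1) ∧
    (∀ x, x ∉ Set.Ioo (1 / 4 : ℝ) (9 / 4) → b x = 0) ∧
    (∀ x ∈ Set.Icc (1 / 2 : ℝ) 2, b x = 1) ∧ HasCompactSupport b := by
  let B : ContDiffBump (5 / 4 : ℝ) := ⟨3 / 4, 1, by norm_num, by norm_num⟩
  refine ⟨B, B.contDiff, fun x => ⟨B.nonneg, B.le_one⟩, fun x hx => ?_, fun x hx => ?_,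
    B.hasCompactSupport⟩
  · apply B.zero_of_le_dist
    by_contra h
    push Not at h
    rw [Real.dist_eq, abs_lt] at h
    apply hx
    have hr : B.rOut = 1 := rfl
    rw [hr] at h
    constructor <;> linarith [h.1, h.2]
  · apply B.one_of_mem_closedBall
    rw [Metric.mem_closedBall, Real.dist_eq, abs_le]
    have : B.rIn = 3 / 4 := rfl
    rw [this]
    constructor <;> linarith [hx.1, hx.2]

theorem bounded_derivs (g : ℝ → ℝ) (hg : ContDiff ℝ (⊤ : ℕ∞) g) (hc : HasCompactSupport g) :
    ∃ g1 g2 : ℝ → ℝ, ∃ D : ℝ, 0 ≤ D ∧ (∀ x, HasDerivAt g (g1 x) x) ∧ (∀ x, HasDerivAt g1 (g2 x) x) ∧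
      Continuous g2 ∧ (∀ x, |g1 x| ≤ D) ∧ (∀ x, |g2 x| ≤ D) := by
  have hd : ContDiff ℝ (⊤ : ℕ∞) (deriv g) := (contDiff_infty_iff_deriv.1 hg).2
  have hdd : ContDiff ℝ (⊤ : ℕ∞) (deriv (deriv g)) := (contDiff_infty_iff_deriv.1 hd).2
  obtain ⟨D1, h1⟩ := hc.deriv.exists_bound_of_continuous hd.continuous
  obtain ⟨D2, h2⟩ := hc.deriv.deriv.exists_bound_of_continuous hdd.continuous
  refine ⟨deriv g, deriv (deriv g), max D1 D2, le_trans (norm_nonneg _) ((h1 0).trans (le_max_left _ _)),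
    fun x => (hg.differentiable (by simp) x).hasDerivAt,
    fun x => (hd.differentiable (by simp) x).hasDerivAt, hdd.continuous,
    fun x => (h1 x).trans (le_max_left _ _), fun x => (h2 x).trans (le_max_right _ _)⟩

theorem kernel_bound (η b : ℝ → ℝ) (hη : ContDiff ℝ (⊤ : ℕ∞) η)
    (hηr : ∀ ξ, η ξ ∈ Set.Icc (0 : ℝ) 1)
    (hηs : Function.support η ⊆ Set.Icc (-8/5 : ℝ) (8/5))
    (hb : ContDiff ℝ (⊤ : ℕ∞) b) (hbr : ∀ x, b x ∈ Set.Icc (0 : ℝ) 1)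
    (hbs : ∀ x, x ∉ Set.Ioo (1 / 4 : ℝ) (9 / 4) → b x = 0) (hbc : HasCompactSupport b) :
    ∃ C : ℝ, 0 ≤ C ∧ ∀ δ τ y : ℝ, 0 < δ → δ ≤ 1 →
      (1 + (δ * y) ^ 2) * ‖∫ ξ : ℝ, Complex.exp (Complex.I * ((y * ξ : ℝ) : ℂ)) *
        ((η ((τ + ξ ^ 2) / δ) * b ξ : ℝ) : ℂ)‖ ≤ C * δ := by
  have hηc : HasCompactSupport η := HasCompactSupport.intro (isCompact_Icc (a := -8/5) (b := 8/5))
    (fun x hx => by by_contra h; exact hx (hηs h))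
  obtain ⟨e1, e2, E, hE, he1, he2, hce, hE1, hE2⟩ := bounded_derivs η hη hηc
  obtain ⟨b1, b2, B, hB, hb1, hb2, hcb, hB1, hB2⟩ := bounded_derivs b hb hbc
  have hb0 : ∀ x, 9 / 4 < |x| → b x = 0 ∧ b1 x = 0 ∧ b2 x = 0 := by
    intro x hx
    have hx' : x ∈ {z : ℝ | 9 / 4 < |z|} := hx
    have ho : IsOpen {z : ℝ | 9 / 4 < |z|} := isOpen_lt continuous_const continuous_abs
    have z0 : ∀ z ∈ {z : ℝ | 9 / 4 < |z|}, b z = 0 := by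
      intro z hz
      apply hbs
      intro h
      have : |z| = z := abs_of_pos (by linarith [h.1])
      have h3 : 9 / 4 < |z| := hz
      linarith [h.2]
    have z1 : ∀ z ∈ {z : ℝ | 9 / 4 < |z|}, b1 z = 0 := by
      intro z hz
      refine (hb1 z).unique ((hasDerivAt_const z (0 : ℝ)).congr_of_eventuallyEq ?_)
      filter_upwards [ho.mem_nhds hz] with w hw using z0 w hw
    refine ⟨z0 x hx', z1 x hx', ?_⟩
    refine (hb2 x).unique ((hasDerivAt_const x (0 : ℝ)).congr_of_eventuallyEq ?_)
    filter_upwards [ho.mem_nhds hx'] with w hw using z1 w hw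
  set Q : ℝ := 25 * E + 2 * E + 10 * E * B + B with hQ
  have hQ0 : 0 ≤ Q := by positivity
  refine ⟨2 * 7 * (1 + Q), by positivity, ?_⟩
  intro δ τ y hδ hδ1
  let r : ℝ → ℝ := fun x => η ((τ + x ^ 2) / δ) * b x
  let r1 : ℝ → ℝ := fun x => e1 ((τ + x ^ 2) / δ) * (2 * x / δ) * b x + η ((τ + x ^ 2) / δ) * b1 x
  let r2 : ℝ → ℝ := fun x => e2 ((τ + x ^ 2) / δ) * (2 * x / δ) ^ 2 * b x
    + e1 ((τ + x ^ 2) / δ) * (2 / δ) * b x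
    + 2 * (e1 ((τ + x ^ 2) / δ) * (2 * x / δ) * b1 x) + η ((τ + x ^ 2) / δ) * b2 x
  have hph : ∀ x, HasDerivAt (fun x : ℝ => (τ + x ^ 2) / δ) (2 * x / δ) x := by
    intro x
    have := (((hasDerivAt_id x).pow 2).const_add τ).div_const δ
    simpa using this
  have hlin : ∀ x : ℝ, HasDerivAt (fun x : ℝ => 2 * x / δ) (2 / δ) x := by
    intro x
    have := ((hasDerivAt_id x).const_mul 2).div_const δ
    simpa using this
  have hηd : ∀ x, HasDerivAt (fun x => η ((τ + x ^ 2) / δ)) (e1 ((τ + x ^ 2) / δ) * (2 * x / δ)) x :=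
    fun x => (he1 _).comp x (hph x)
  have he1d : ∀ x, HasDerivAt (fun x => e1 ((τ + x ^ 2) / δ)) (e2 ((τ + x ^ 2) / δ) * (2 * x / δ)) x :=
    fun x => (he2 _).comp x (hph x)
  have hr1 : ∀ x, HasDerivAt r (r1 x) x := fun x => (hηd x).mul (hb1 x)
  have hr2 : ∀ x, HasDerivAt r1 (r2 x) x := by
    intro x
    have := (((he1d x).mul (hlin x)).mul (hb1 x)).add ((hηd x).mul (hb2 x))
    refine this.congr_deriv ?_
    simp only [r2, Pi.mul_apply]; ring
  have cη : Continuous η := hη.continuous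
  have cb : Continuous b := hb.continuous
  have ce1 : Continuous e1 := continuous_iff_continuousAt.2 fun x => (he2 x).continuousAt
  have cb1 : Continuous b1 := continuous_iff_continuousAt.2 fun x => (hb2 x).continuousAt
  have hcr2 : Continuous r2 := by simp only [r2]; fun_prop
  have hrP : ∀ x, |r x| ≤ 1 := by
    intro x
    simp only [r, abs_mul]
    have h1 := hηr ((τ + x ^ 2) / δ)
    have h2 := hbr x
    rw [abs_of_nonneg h1.1, abs_of_nonneg h2.1]
    exact mul_le_one₀ h1.2 h2.1 h2.2
  have hrQ : ∀ x, |r2 x| ≤ Q / δ ^ 2 := by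
    intro x
    by_cases hx : 9 / 4 < |x|
    · obtain ⟨h0, h1, h2⟩ := hb0 x hx
      simp only [r2, h0, h1, h2]
      simp; positivity
    push Not at hx
    have hi : 1 ≤ 1 / δ := by rw [le_div_iff₀ hδ]; linarith
    have hl : |2 * x / δ| ≤ 5 * (1 / δ) := by
      rw [abs_div, abs_mul, abs_of_pos hδ, abs_of_pos (by norm_num : (0:ℝ) < 2), div_eq_mul_one_div]
      gcongr; linarith
    have habs : ∀ {u v : ℝ}, |u| ≤ v → 0 ≤ v := fun h => (abs_nonneg _).trans h
    have hbx : |b x| ≤ 1 := by rw [abs_of_nonneg (hbr x).1]; exact (hbr x).2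
    have hηx : |η ((τ + x ^ 2) / δ)| ≤ 1 := by rw [abs_of_nonneg (hηr _).1]; exact (hηr _).2
    set D := 1 / δ with hD
    have hDD : D ≤ D ^ 2 := by nlinarith
    have t1 : |e2 ((τ + x ^ 2) / δ) * (2 * x / δ) ^ 2 * b x| ≤ E * (5 * D) ^ 2 * 1 := by
      rw [abs_mul, abs_mul, abs_pow]
      gcongr
      exact hE2 _
    have t2 : |e1 ((τ + x ^ 2) / δ) * (2 / δ) * b x| ≤ E * (2 * D) * 1 := by
      rw [abs_mul, abs_mul]
      gcongr
      · exact hE1 _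
      · rw [abs_of_pos (by positivity), hD]; apply le_of_eq; ring
    have t3 : |2 * (e1 ((τ + x ^ 2) / δ) * (2 * x / δ) * b1 x)| ≤ 2 * (E * (5 * D) * B) := by
      rw [abs_mul, abs_mul, abs_mul, abs_of_pos (by norm_num : (0:ℝ) < 2)]
      gcongr
      · exact hE1 _
      · exact hB1 _
    have t4 : |η ((τ + x ^ 2) / δ) * b2 x| ≤ 1 * B := by
      rw [abs_mul]
      gcongr
      exact hB2 _
    have hsum : |r2 x| ≤ E * (5 * D) ^ 2 * 1 + E * (2 * D) * 1 + 2 * (E * (5 * D) * B) + 1 * B :=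
      (abs_add_le _ _).trans (add_le_add ((abs_add_le _ _).trans (add_le_add
        ((abs_add_le _ _).trans (add_le_add t1 t2)) t3)) t4)
    refine hsum.trans ?_
    have : Q / δ ^ 2 = Q * D ^ 2 := by rw [hD]; field_simp
    rw [this, hQ]
    have h1D : 1 ≤ D ^ 2 := by nlinarith
    have q1 : E * D ≤ E * D ^ 2 := by gcongr
    have q2 : (E * B) * D ≤ (E * B) * D ^ 2 := by gcongr
    have q3 : B * 1 ≤ B * D ^ 2 := by gcongr
    nlinarith
  obtain ⟨c, hc⟩ : ∃ c : ℝ, ∀ x, x ∉ Set.Icc (c - 7 * δ) (c + 7 * δ) → r x = 0 := by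
    by_cases hne : ∃ c, r c ≠ 0
    · obtain ⟨c, hc⟩ := hne
      refine ⟨c, fun x hx => ?_⟩
      by_contra hrx
      apply hx
      have key : ∀ z, r z ≠ 0 → 1 / 4 < z ∧ |τ + z ^ 2| ≤ 8 / 5 * δ := by
        intro z hz
        have hz1 : η ((τ + z ^ 2) / δ) ≠ 0 := left_ne_zero_of_mul hz
        have hz2 : b z ≠ 0 := right_ne_zero_of_mul hz
        have h1 := hηs hz1
        refine ⟨?_, ?_⟩
        · by_contra hh
          exact hz2 (hbs z (fun h => hh h.1))
        · have h3 := h1.1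
          have h4 := h1.2
          rw [le_div_iff₀ hδ] at h3
          rw [div_le_iff₀ hδ] at h4
          rw [abs_le]; constructor <;> linarith
      obtain ⟨c1, c2⟩ := key c hc
      obtain ⟨x1, x2⟩ := key x hrx
      rw [abs_le] at c2 x2
      constructor <;> nlinarith
    · push Not at hne
      exact ⟨0, fun x _ => hne x⟩
  have hosc := osc_bound (m := fun x => ((r x : ℝ) : ℂ)) (m1 := fun x => ((r1 x : ℝ) : ℂ))
    (m2 := fun x => ((r2 x : ℝ) : ℂ)) (c := c) (R := 7 * δ) (P := 1) (Q := Q / δ ^ 2) (by positivity)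
    (fun x hx => by rw [hc x hx]; simp) (fun x => (hr1 x).ofReal_comp) (fun x => (hr2 x).ofReal_comp)
    (Complex.continuous_ofReal.comp hcr2)
    (fun x => by simpa using hrP x) (fun x => by simpa using hrQ x) y
  obtain ⟨o1, o2⟩ := hosc
  simp only [r] at o1 o2
  set K := ‖∫ ξ : ℝ, Complex.exp (Complex.I * ((y * ξ : ℝ) : ℂ)) *
        ((η ((τ + ξ ^ 2) / δ) * b ξ : ℝ) : ℂ)‖ with hK
  have o3 : δ ^ 2 * (y ^ 2 * K) ≤ δ ^ 2 * (2 * (7 * δ) * (Q / δ ^ 2)) := by gcongr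
  have o4 : δ ^ 2 * (2 * (7 * δ) * (Q / δ ^ 2)) = 2 * 7 * Q * δ := by field_simp
  nlinarith


theorem cs_lint {α : Type*} [MeasurableSpace α] (μ : Measure α) (f g : α → ℝ≥0∞)
    (hf : AEMeasurable f μ) (hg : AEMeasurable g μ) :
    ∫⁻ a, f a * g a ∂μ ≤ (∫⁻ a, f a ^ 2 ∂μ) ^ (1 / 2 : ℝ) * (∫⁻ a, g a ^ 2 ∂μ) ^ (1 / 2 : ℝ) := by
  have := ENNReal.lintegral_mul_le_Lp_mul_Lq μ (p := 2) (q := 2) Real.HolderConjugate.two_two hf hg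
  simpa using this

theorem minkowski_two (F : ℝ → ℝ → ℝ≥0∞) (hF : Measurable (Function.uncurry F)) :
    (∫⁻ τ, (∫⁻ y, F y τ) ^ 2) ^ (1 / 2 : ℝ) ≤ ∫⁻ y, (∫⁻ τ, F y τ ^ 2) ^ (1 / 2 : ℝ) := by
  set a : ℝ → ℝ≥0∞ := fun y => (∫⁻ τ, F y τ ^ 2) ^ (1 / 2 : ℝ) with ha
  have m1 : ∀ y, Measurable (F y) := fun y => hF.comp measurable_prodMk_left
  have m2 : ∀ τ, Measurable (fun y => F y τ) := fun y => hF.comp measurable_prodMk_right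
  have mi : Measurable (fun τ => ∫⁻ y, F y τ) := hF.lintegral_prod_left'
  have ma : Measurable a := by
    have : Measurable (fun y => ∫⁻ τ, F y τ ^ 2) := (hF.pow_const 2).lintegral_prod_right'
    exact this.pow_const _
  have e : ∫⁻ τ, (∫⁻ y, F y τ) ^ 2 ≤ (∫⁻ y, a y) ^ 2 := by
    calc ∫⁻ τ, (∫⁻ y, F y τ) ^ 2 = ∫⁻ τ, ∫⁻ y, F y τ * ∫⁻ z, F z τ := by
          congr 1; ext τ
          rw [lintegral_mul_const _ (m2 τ), sq]
      _ = ∫⁻ y, ∫⁻ τ, F y τ * ∫⁻ z, F z τ := by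
          apply lintegral_lintegral_swap
          have : Measurable (fun p : ℝ × ℝ => F p.2 p.1 * ∫⁻ z, F z p.1) :=
            (hF.comp measurable_swap).mul (mi.comp measurable_fst)
          exact this.aemeasurable
      _ = ∫⁻ y, ∫⁻ z, ∫⁻ τ, F y τ * F z τ := by
          congr 1; ext y
          rw [lintegral_lintegral_swap]
          · congr 1; ext τ
            rw [lintegral_const_mul _ (m2 τ)]
          · have : Measurable (fun p : ℝ × ℝ => F y p.2 * F p.1 p.2) :=
              ((m1 y).comp measurable_snd).mul hF
            exact this.aemeasurable
      _ ≤ ∫⁻ y, ∫⁻ z, a y * a z := by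
          gcongr with y z
          exact cs_lint volume (F y) (F z) (m1 y).aemeasurable (m1 z).aemeasurable
      _ = (∫⁻ y, a y) ^ 2 := by
          simp_rw [lintegral_const_mul _ ma]
          rw [lintegral_mul_const _ ma, sq]
  calc _ ≤ ((∫⁻ y, a y) ^ 2) ^ (1 / 2 : ℝ) := by gcongr
    _ = _ := by
      rw [← ENNReal.rpow_natCast, ← ENNReal.rpow_mul]; norm_num

theorem young_lint (G : ℝ → ℝ≥0∞) (hG : Measurable G) (a : ℝ → ℝ≥0∞) (ha : Measurable a) :
    ∫⁻ x, ∫⁻ y, G (x - y) * a y = (∫⁻ x, G x) * ∫⁻ y, a y := by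
  rw [lintegral_lintegral_swap]
  · rw [← lintegral_const_mul _ ha]
    congr 1; ext y
    rw [lintegral_mul_const _ (by fun_prop)]
    rw [lintegral_sub_right_eq_self (fun x => G x) y]
  · have : Measurable (fun p : ℝ × ℝ => G (p.1 - p.2) * a p.2) := by fun_prop
    exact this.aemeasurable

/-- The product plane with its Euclidean norm. -/
abbrev E2 := WithLp 2 (ℝ × ℝ)

theorem F2_eq_fourier (g : E2 → ℂ) (q : ℝ × ℝ) :
    F2 (fun p => g (WithLp.toLp 2 p)) q = 𝓕 g (WithLp.toLp 2 ((2 * Real.pi)⁻¹ • q)) := by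
  rw [F2, Real.fourier_eq', ← (WithLp.volume_preserving_toLp (U := ℝ) (V := ℝ)).integral_comp
    (MeasurableEquiv.toLp 2 (ℝ × ℝ)).measurableEmbedding]
  congr 1; ext p
  rw [smul_eq_mul]
  congr 2
  simp only [WithLp.prod_inner_apply, Prod.smul_fst, Prod.smul_snd, smul_eq_mul, RCLike.inner_apply,
    conj_trivial]
  have : (Real.pi : ℂ) ≠ 0 := by exact_mod_cast Real.pi_pos.ne'
  push_cast
  field_simp

theorem F2inv_eq_fourier (g : E2 → ℂ) (q : ℝ × ℝ) :
    F2inv (fun p => g (WithLp.toLp 2 p)) q =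
      ((((2 * Real.pi) ^ 2 : ℝ)⁻¹ : ℝ) : ℂ) * 𝓕⁻ g (WithLp.toLp 2 ((2 * Real.pi)⁻¹ • q)) := by
  rw [F2inv, Real.fourierInv_eq', ← (WithLp.volume_preserving_toLp (U := ℝ) (V := ℝ)).integral_comp
    (MeasurableEquiv.toLp 2 (ℝ × ℝ)).measurableEmbedding]
  congr 2; ext p
  rw [smul_eq_mul]
  congr 2
  simp only [WithLp.prod_inner_apply, Prod.smul_fst, Prod.smul_snd, smul_eq_mul, RCLike.inner_apply,
    conj_trivial]
  have : (Real.pi : ℂ) ≠ 0 := by exact_mod_cast Real.pi_pos.ne'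
  push_cast
  field_simp

/-- Linear rescaling by `(2π)⁻¹`, onto the Euclidean plane. -/
def rescale : (ℝ × ℝ) ≃L[ℝ] E2 :=
  (ContinuousLinearEquiv.smulLeft (R₁ := ℝ) (M₁ := ℝ × ℝ)
    (Units.mk0 ((2 * Real.pi)⁻¹ : ℝ) (by have := Real.pi_pos; positivity))).trans
    (WithLp.prodContinuousLinearEquiv 2 ℝ ℝ ℝ).symm

theorem rescale_apply (q : ℝ × ℝ) : rescale q = WithLp.toLp 2 ((2 * Real.pi)⁻¹ • q) := rfl

theorem schwartz_inverse (f : 𝓢(ℝ × ℝ, ℂ)) :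
    ∃ U : 𝓢(ℝ × ℝ, ℂ), (∀ p, F2inv (⇑f) p = U p) ∧ ∀ q, f q = F2 (⇑U) q := by
  let g : 𝓢(E2, ℂ) := SchwartzMap.compCLMOfContinuousLinearEquiv ℂ
    (WithLp.prodContinuousLinearEquiv 2 ℝ ℝ ℝ) f
  let g' : 𝓢(E2, ℂ) := 𝓕⁻ g
  have hg' : g' = 𝓕⁻ g := rfl
  have hg : (⇑f) = fun p => g (WithLp.toLp 2 p) := rfl
  let c : ℂ := ((((2 * Real.pi) ^ 2 : ℝ)⁻¹ : ℝ) : ℂ)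
  let U : 𝓢(ℝ × ℝ, ℂ) := c • SchwartzMap.compCLMOfContinuousLinearEquiv ℂ rescale g'
  have hU : ∀ p, U p = c * g' (rescale p) := fun p => rfl
  refine ⟨U, fun p => ?_, fun q => ?_⟩
  · rw [hU, hg, F2inv_eq_fourier, rescale_apply, hg', SchwartzMap.fourierInv_coe]
  · have h1 : f q = 𝓕 (⇑g') (WithLp.toLp 2 q) := by
      have : 𝓕 (𝓕⁻ g) = g := FourierTransform.fourier_fourierInv_eq g
      rw [← SchwartzMap.fourier_coe, hg', this]; rfl
    have h2 := F2_eq_fourier (⇑g') ((2 * Real.pi) • q)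
    rw [smul_smul, inv_mul_cancel₀ (by have := Real.pi_pos; positivity), one_smul, ← h1] at h2
    rw [← h2]
    simp only [F2, hU, rescale_apply]
    have h3 := Measure.integral_comp_smul (volume : Measure (ℝ × ℝ)) (fun p : ℝ × ℝ =>
      Complex.exp (-Complex.I * ((p.1 * ((2 * Real.pi) • q).1 + p.2 * ((2 * Real.pi) • q).2 : ℝ) : ℂ))
        * g' (WithLp.toLp 2 p)) ((2 * Real.pi)⁻¹)
    have hp := Real.pi_pos
    have hd : Module.finrank ℝ (ℝ × ℝ) = 2 := by simp
    rw [hd, abs_of_pos (by positivity), inv_pow, inv_inv] at h3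
    have h4 : ∫ (p : ℝ × ℝ), Complex.exp (-Complex.I * ((p.1 * q.1 + p.2 * q.2 : ℝ) : ℂ)) *
        (c * g' (WithLp.toLp 2 ((2 * Real.pi)⁻¹ • p))) = c * (((2 * Real.pi) ^ 2 : ℝ) •
        ∫ p : ℝ × ℝ, Complex.exp (-Complex.I * ((p.1 * ((2 * Real.pi) • q).1 + p.2 * ((2 * Real.pi) • q).2 : ℝ) : ℂ))
        * g' (WithLp.toLp 2 p)) := by
      rw [← h3, ← integral_const_mul]
      congr 1; ext p
      rw [mul_left_comm]
      congr 4
      simp only [Prod.smul_fst, Prod.smul_snd, smul_eq_mul]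
      field_simp
    rw [h4, Complex.real_smul, ← mul_assoc]
    simp only [c]
    rw [← Complex.ofReal_mul, inv_mul_cancel₀ (by positivity)]
    simp

theorem schwartz_decay (U : 𝓢(ℝ × ℝ, ℂ)) :
    ∃ C : ℝ, 0 ≤ C ∧ ∀ x t : ℝ, ‖U (x, t)‖ ≤ C * ((1 + x ^ 2)⁻¹ * (1 + t ^ 2)⁻¹) := by
  obtain ⟨C, hC⟩ : ∃ C, ∀ p : ℝ × ℝ, (1 + ‖p‖) ^ 4 * ‖U p‖ ≤ C := by
    refine ⟨2 ^ 4 * (Finset.Iic (4, 0)).sup (fun m : ℕ × ℕ => SchwartzMap.seminorm ℝ m.1 m.2) U, fun p => ?_⟩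
    have := SchwartzMap.one_add_le_sup_seminorm_apply (𝕜 := ℝ) (m := (4, 0)) (k := 4) (n := 0)
      le_rfl le_rfl U p
    simpa using this
  refine ⟨C, le_trans (by positivity) (hC 0), fun x t => ?_⟩
  rw [← mul_inv, ← div_eq_mul_inv, le_div_iff₀ (by positivity)]
  refine le_trans ?_ (hC (x, t))
  rw [mul_comm]
  gcongr
  have h1 : |x| ≤ ‖(x, t)‖ := norm_fst_le (x, t)
  have h2 : |t| ≤ ‖(x, t)‖ := norm_snd_le (x, t)
  have h3 : 1 + x ^ 2 ≤ (1 + ‖(x, t)‖) ^ 2 := by rw [← sq_abs x]; nlinarith [abs_nonneg x]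
  have h4 : 1 + t ^ 2 ≤ (1 + ‖(x, t)‖) ^ 2 := by rw [← sq_abs t]; nlinarith [abs_nonneg t]
  calc _ ≤ (1 + ‖(x, t)‖) ^ 2 * (1 + ‖(x, t)‖) ^ 2 := by gcongr
    _ = _ := by ring


theorem kernel_full (η b : ℝ → ℝ) (hηe : ∀ ξ, η (-ξ) = η ξ) (hηc : Continuous η) (hbcont : Continuous b)
    (hbs : ∀ x, x ∉ Set.Ioo (1 / 4 : ℝ) (9 / 4) → b x = 0) (hbc : HasCompactSupport b) (C : ℝ)
    (hK : ∀ δ τ y : ℝ, 0 < δ → δ ≤ 1 →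
      (1 + (δ * y) ^ 2) * ‖∫ ξ : ℝ, Complex.exp (Complex.I * ((y * ξ : ℝ) : ℂ)) *
        ((η ((τ + ξ ^ 2) / δ) * b ξ : ℝ) : ℂ)‖ ≤ C * δ)
    (L J : ℝ) (hL : 0 < L) (hJ : 0 < J) (hJL : J ≤ L ^ 2) (τ z : ℝ) :
    Integrable (fun ξ : ℝ => ((η ((τ - ω ξ) / J) * (b (ξ / L) + b (-ξ / L)) : ℝ) : ℂ)) ∧
    ‖∫ ξ : ℝ, Complex.exp (Complex.I * ((z * ξ : ℝ) : ℂ)) *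
      ((η ((τ - ω ξ) / J) * (b (ξ / L) + b (-ξ / L)) : ℝ) : ℂ)‖ ≤
      2 * C * (J / L) * (1 + (J / L * z) ^ 2)⁻¹ := by
  have hcs : HasCompactSupport (fun x => b (x / L)) := by
    have := hbc.comp_homeomorph (Homeomorph.mulRight₀ L⁻¹ (by positivity))
    simpa [Function.comp_def, div_eq_mul_inv] using! this
  have hint : ∀ τ : ℝ, Integrable (fun ξ : ℝ => ((η ((τ + ξ ^ 2) / J) * b (ξ / L) : ℝ) : ℂ)) := by
    intro τ
    have hcc : Continuous (fun ξ : ℝ => η ((τ + ξ ^ 2) / J) * b (ξ / L)) := by fun_prop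
    have hh : Integrable (fun ξ : ℝ => η ((τ + ξ ^ 2) / J) * b (ξ / L)) :=
      hcc.integrable_of_hasCompactSupport hcs.mul_left
    exact hh.ofReal
  have hint' : ∀ τ z : ℝ, Integrable (fun ξ : ℝ => Complex.exp (Complex.I * ((z * ξ : ℝ) : ℂ)) *
      ((η ((τ + ξ ^ 2) / J) * b (ξ / L) : ℝ) : ℂ)) := by
    intro τ z
    refine (hint τ).bdd_mul (c := 1) (by fun_prop) ?_
    refine Filter.Eventually.of_forall fun ξ => ?_
    rw [mul_comm Complex.I, Complex.norm_exp_ofReal_mul_I]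
  have hdec : ∀ ξ : ℝ, ((η ((τ - ω ξ) / J) * (b (ξ / L) + b (-ξ / L)) : ℝ) : ℂ) =
      ((η ((τ + ξ ^ 2) / J) * b (ξ / L) : ℝ) : ℂ)
      + ((η ((-τ + (-ξ) ^ 2) / J) * b (-ξ / L) : ℝ) : ℂ) := by
    intro ξ
    rw [← Complex.ofReal_add]
    congr 1
    rcases le_or_gt ξ 0 with h | h
    · have h0 : b (ξ / L) = 0 := hbs _ (fun hh => by
        have : ξ / L ≤ 0 := div_nonpos_of_nonpos_of_nonneg h hL.le
        linarith [hh.1])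
      have : (-τ + (-ξ) ^ 2) / J = -((τ - ω ξ) / J) := by
        rw [ω, abs_of_nonpos h]; ring
      rw [h0, this, hηe]; ring
    · have h0 : b (-ξ / L) = 0 := hbs _ (fun hh => by
        have : -ξ / L ≤ 0 := div_nonpos_of_nonpos_of_nonneg (by linarith) hL.le
        linarith [hh.1])
      have : (τ + ξ ^ 2) / J = ((τ - ω ξ) / J) := by
        rw [ω, abs_of_pos h]; ring
      rw [h0, this]; ring
  have hT : ∀ τ z : ℝ, ‖∫ ξ : ℝ, Complex.exp (Complex.I * ((z * ξ : ℝ) : ℂ)) *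
      ((η ((τ + ξ ^ 2) / J) * b (ξ / L) : ℝ) : ℂ)‖ ≤ C * (J / L) * (1 + (J / L * z) ^ 2)⁻¹ := by
    intro τ z
    have e := Measure.integral_comp_div (fun s : ℝ => Complex.exp (Complex.I * (((z * L) * s : ℝ) : ℂ)) *
      ((η ((τ / L ^ 2 + s ^ 2) / (J / L ^ 2)) * b s : ℝ) : ℂ)) L
    have e2 : ∫ ξ : ℝ, Complex.exp (Complex.I * ((z * ξ : ℝ) : ℂ)) *
      ((η ((τ + ξ ^ 2) / J) * b (ξ / L) : ℝ) : ℂ) = ∫ ξ : ℝ,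
        Complex.exp (Complex.I * (((z * L) * (ξ / L) : ℝ) : ℂ)) *
      ((η ((τ / L ^ 2 + (ξ / L) ^ 2) / (J / L ^ 2)) * b (ξ / L) : ℝ) : ℂ) := by
      congr 1; ext ξ
      have a1 : (z * L) * (ξ / L) = z * ξ := by field_simp
      have a2 : (τ / L ^ 2 + (ξ / L) ^ 2) / (J / L ^ 2) = (τ + ξ ^ 2) / J := by field_simp
      rw [a1, a2]
    rw [e2, e, norm_smul, Real.norm_eq_abs, abs_abs, abs_of_pos hL]
    have := hK (J / L ^ 2) (τ / L ^ 2) (z * L) (by positivity) (by rw [div_le_one (by positivity)]; exact hJL)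
    have a3 : J / L ^ 2 * (z * L) = J / L * z := by field_simp
    rw [a3] at this
    rw [← div_eq_mul_inv, le_div_iff₀ (by positivity)]
    have a4 : C * (J / L) = L * (C * (J / L ^ 2)) := by field_simp
    rw [a4]
    calc _ = L * ((1 + (J / L * z) ^ 2) * ‖∫ ξ : ℝ, Complex.exp (Complex.I * (((z * L) * ξ : ℝ) : ℂ)) *
        ((η ((τ / L ^ 2 + ξ ^ 2) / (J / L ^ 2)) * b ξ : ℝ) : ℂ)‖) := by ring
      _ ≤ _ := by gcongr
  refine ⟨?_, ?_⟩
  · simp_rw [hdec]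
    exact (hint τ).add ((hint (-τ)).comp_neg)
  · simp_rw [hdec, mul_add]
    have e3 : ∀ ξ : ℝ, Complex.exp (Complex.I * ((z * ξ : ℝ) : ℂ)) *
        ((η ((-τ + (-ξ) ^ 2) / J) * b (-ξ / L) : ℝ) : ℂ) =
        (fun ξ : ℝ => Complex.exp (Complex.I * (((-z) * ξ : ℝ) : ℂ)) *
        ((η ((-τ + ξ ^ 2) / J) * b (ξ / L) : ℝ) : ℂ)) (-ξ) := by
      intro ξ
      simp only [neg_mul_neg]
    simp_rw [e3]
    rw [integral_add (hint' τ z) ((hint' (-τ) (-z)).comp_neg)]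
    rw [integral_neg_eq_self (fun ξ : ℝ => Complex.exp (Complex.I * (((-z) * ξ : ℝ) : ℂ)) *
        ((η ((-τ + ξ ^ 2) / J) * b (ξ / L) : ℝ) : ℂ)) volume]
    have h1 := hT τ z
    have h2 := hT (-τ) (-z)
    rw [mul_neg, neg_sq] at h2
    refine (norm_add_le _ _).trans ((add_le_add h1 h2).trans (le_of_eq ?_))
    ring

theorem norm_exp_I (r : ℝ) : ‖Complex.exp (Complex.I * (r : ℂ))‖ = 1 := by
  rw [mul_comm, Complex.norm_exp_ofReal_mul_I]

theorem conv_bound (m a : ℝ → ℂ) (hm : Integrable m) (ha : Integrable a) (x : ℝ) (K : ℝ → ℝ)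
    (hK : ∀ z, ‖∫ ξ : ℝ, Complex.exp (Complex.I * ((z * ξ : ℝ) : ℂ)) * m ξ‖ ≤ K z) :
    ‖∫ ξ : ℝ, Complex.exp (Complex.I * ((x * ξ : ℝ) : ℂ)) * (m ξ *
      ∫ y : ℝ, Complex.exp (Complex.I * ((-1 * (y * ξ) : ℝ) : ℂ)) * a y)‖ₑ ≤
      ∫⁻ y, ENNReal.ofReal (K (x - y)) * ‖a y‖ₑ := by
  have e1 : ∫ ξ : ℝ, Complex.exp (Complex.I * ((x * ξ : ℝ) : ℂ)) * (m ξ *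
      ∫ y : ℝ, Complex.exp (Complex.I * ((-1 * (y * ξ) : ℝ) : ℂ)) * a y) =
      ∫ y : ℝ, (∫ ξ : ℝ, Complex.exp (Complex.I * (((x - y) * ξ : ℝ) : ℂ)) * m ξ) * a y := by
    calc _ = ∫ ξ : ℝ, ∫ y : ℝ, Complex.exp (Complex.I * (((x - y) * ξ : ℝ) : ℂ)) * (m ξ * a y) := by
          congr 1; ext ξ
          rw [← mul_assoc, ← integral_const_mul]
          congr 1; ext y
          have : Complex.exp (Complex.I * (((x - y) * ξ : ℝ) : ℂ)) =
              Complex.exp (Complex.I * ((x * ξ : ℝ) : ℂ)) *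
              Complex.exp (Complex.I * ((-1 * (y * ξ) : ℝ) : ℂ)) := by
            rw [← Complex.exp_add]; congr 1; push_cast; ring
          rw [this]; ring
      _ = ∫ y : ℝ, ∫ ξ : ℝ, Complex.exp (Complex.I * (((x - y) * ξ : ℝ) : ℂ)) * (m ξ * a y) := by
          apply integral_integral_swap
          have := hm.mul_prod ha
          refine this.bdd_mul (c := 1) (Continuous.aestronglyMeasurable (by fun_prop)) ?_
          exact Filter.Eventually.of_forall fun p => (norm_exp_I _).le
      _ = _ := by
          congr 1; ext y
          rw [← integral_mul_const]
          congr 1; ext ξ; ring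
  rw [e1]
  refine (enorm_integral_le_lintegral_enorm _).trans ?_
  gcongr with y
  rw [enorm_mul]
  gcongr
  rw [← ofReal_norm]
  exact ENNReal.ofReal_le_ofReal (hK _)

/-- The `L²` norm as an extended nonnegative real. -/
def N2 (h : ℝ → ℂ) : ℝ≥0∞ := (∫⁻ t, ‖h t‖ₑ ^ 2) ^ (1 / 2 : ℝ)

theorem eLpNorm_two (h : ℝ → ℂ) : eLpNorm h 2 volume = N2 h := by
  rw [eLpNorm_eq_lintegral_rpow_enorm_toReal (by norm_num) (by norm_num), N2]
  simp

theorem lint_poisson : ∫⁻ t : ℝ, ENNReal.ofReal ((1 + t ^ 2)⁻¹) = ENNReal.ofReal Real.pi := by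
  rw [← ofReal_integral_eq_lintegral_ofReal integrable_inv_one_add_sq
    (Filter.Eventually.of_forall fun t => by positivity), integral_univ_inv_one_add_sq]

theorem lint_poisson_scaled (D c : ℝ) (hD : 0 < D) (hc : 0 ≤ c) :
    ∫⁻ t : ℝ, ENNReal.ofReal (c * D * (1 + (D * t) ^ 2)⁻¹) = ENNReal.ofReal (c * Real.pi) := by
  have : ∀ t : ℝ, ENNReal.ofReal (c * D * (1 + (D * t) ^ 2)⁻¹) =
      ENNReal.ofReal (c * D) * ENNReal.ofReal ((1 + (D * t) ^ 2)⁻¹) := by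
    intro t; rw [ENNReal.ofReal_mul (by positivity)]
  simp_rw [this]
  rw [lintegral_const_mul _ (by fun_prop), lint_comp_mul (fun t => ENNReal.ofReal ((1 + t ^ 2)⁻¹)) D hD.ne',
    lint_poisson, ← ENNReal.ofReal_mul (by positivity), ← ENNReal.ofReal_mul (by positivity)]
  congr 1
  rw [abs_of_pos (by positivity)]
  field_simp

theorem half_sq (a : ℝ≥0∞) : (a ^ 2) ^ (1 / 2 : ℝ) = a := by
  rw [← ENNReal.rpow_natCast, ← ENNReal.rpow_mul]; norm_num

theorem slice_bound (U : 𝓢(ℝ × ℝ, ℂ)) : ∃ C : ℝ, 0 ≤ C ∧ ∀ x : ℝ,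
    N2 (fun t => U (x, t)) ≤ ENNReal.ofReal (C * (1 + x ^ 2)⁻¹) * ENNReal.ofReal Real.pi ^ (1 / 2 : ℝ) := by
  obtain ⟨C, hC, h⟩ := schwartz_decay U
  refine ⟨C, hC, fun x => ?_⟩
  calc N2 (fun t => U (x, t)) ≤
      (∫⁻ t : ℝ, ENNReal.ofReal (C * (1 + x ^ 2)⁻¹) ^ 2 * ENNReal.ofReal ((1 + t ^ 2)⁻¹)) ^ (1 / 2 : ℝ) := by
        unfold N2
        gcongr with t
        have h1 : ‖U (x, t)‖ₑ ≤ ENNReal.ofReal (C * (1 + x ^ 2)⁻¹) * ENNReal.ofReal ((1 + t ^ 2)⁻¹) := by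
          rw [← ENNReal.ofReal_mul (by positivity), ← ofReal_norm]
          apply ENNReal.ofReal_le_ofReal
          rw [mul_assoc]; exact h x t
        have h2 : ENNReal.ofReal ((1 + t ^ 2)⁻¹) ≤ 1 := by
          rw [ENNReal.ofReal_le_one]
          exact inv_le_one_of_one_le₀ (by nlinarith)
        calc _ ≤ (ENNReal.ofReal (C * (1 + x ^ 2)⁻¹) * ENNReal.ofReal ((1 + t ^ 2)⁻¹)) ^ 2 := by gcongr
          _ = ENNReal.ofReal (C * (1 + x ^ 2)⁻¹) ^ 2 *
            (ENNReal.ofReal ((1 + t ^ 2)⁻¹) * ENNReal.ofReal ((1 + t ^ 2)⁻¹)) := by ring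
          _ ≤ ENNReal.ofReal (C * (1 + x ^ 2)⁻¹) ^ 2 * (ENNReal.ofReal ((1 + t ^ 2)⁻¹) * 1) := by gcongr
          _ = _ := by rw [mul_one]
    _ = _ := by
      rw [lintegral_const_mul _ (by fun_prop), lint_poisson, ENNReal.mul_rpow_of_nonneg _ _ (by norm_num),
        half_sq]

theorem slice_finite (U : 𝓢(ℝ × ℝ, ℂ)) :
    (∀ x, N2 (fun t => U (x, t)) ≠ ⊤) ∧ ∫⁻ x, N2 (fun t => U (x, t)) ≠ ⊤ := by
  obtain ⟨C, hC, h⟩ := slice_bound U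
  have hp : ENNReal.ofReal Real.pi ^ (1 / 2 : ℝ) ≠ ⊤ :=
    ENNReal.rpow_ne_top_of_nonneg (by norm_num) ENNReal.ofReal_ne_top
  refine ⟨fun x => ne_top_of_le_ne_top (ENNReal.mul_ne_top ENNReal.ofReal_ne_top hp) (h x), ?_⟩
  refine ne_top_of_le_ne_top ?_ (lintegral_mono h)
  rw [lintegral_mul_const _ (by fun_prop)]
  have := lint_poisson_scaled 1 C one_pos hC
  simp only [mul_one, one_mul] at this
  rw [this]
  exact ENNReal.mul_ne_top ENNReal.ofReal_ne_top hp

theorem mixed_le (u : ℝ → ℝ → ℂ) (S : ℝ≥0∞) (hS : S ≠ ⊤) (h : ∫⁻ x, N2 (u x) ≤ S) :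
    MixedNorm 1 2 u ≤ S.toReal := by
  unfold MixedNorm
  apply ENNReal.toReal_mono hS
  rw [eLpNorm_one_eq_lintegral_enorm]
  refine le_trans (lintegral_mono fun x => ?_) h
  rw [eLpNorm_two, ← ofReal_norm, Real.norm_of_nonneg ENNReal.toReal_nonneg]
  exact ENNReal.ofReal_toReal_le

theorem mixed_eq (u : ℝ → ℝ → ℂ) (h : ∀ x, N2 (u x) ≠ ⊤) :
    MixedNorm 1 2 u = (∫⁻ x, N2 (u x)).toReal := by
  unfold MixedNorm
  rw [eLpNorm_one_eq_lintegral_enorm]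
  congr 2; ext x
  rw [eLpNorm_two, ← ofReal_norm, Real.norm_of_nonneg ENNReal.toReal_nonneg, ENNReal.ofReal_toReal (h x)]

theorem N2_plancherel (s : ℝ) (hs : s ^ 2 = 1) (h : ℝ → ℂ) (h1 : Integrable h) :
    N2 (fun τ : ℝ => ∫ t : ℝ, Complex.exp (Complex.I * ((s * (t * τ) : ℝ) : ℂ)) * h t) ≤
      ENNReal.ofReal (2 * Real.pi) ^ (1 / 2 : ℝ) * N2 h := by
  unfold N2
  rw [← ENNReal.mul_rpow_of_nonneg _ _ (by norm_num)]
  gcongr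
  exact plancherel_exp s hs h h1


theorem core_bound (m : ℝ × ℝ → ℝ) (f U : 𝓢(ℝ × ℝ, ℂ)) (hfU : ∀ q, f q = F2 (⇑U) q)
    (hmc : Continuous m) (B0 : ℝ) (hmb : ∀ q, |m q| ≤ B0) (G : ℝ → ℝ) (hG : Measurable G)
    (hm : ∀ τ, Integrable (fun ξ : ℝ => (m (ξ, τ) : ℂ)))
    (hK : ∀ τ z : ℝ, ‖∫ ξ : ℝ, Complex.exp (Complex.I * ((z * ξ : ℝ) : ℂ)) * (m (ξ, τ) : ℂ)‖ ≤ G z) :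
    ∫⁻ x, N2 (fun t => F2inv (fun q => (m q : ℂ) * f q) (x, t)) ≤
      ENNReal.ofReal (2 * Real.pi) * ((∫⁻ z, ENNReal.ofReal (G z)) * ∫⁻ x, N2 (fun t => U (x, t))) := by
  set P : ℝ≥0∞ := ENNReal.ofReal (2 * Real.pi) ^ (1 / 2 : ℝ) with hP
  have hPP : P * P = ENNReal.ofReal (2 * Real.pi) := by
    rw [hP, ← ENNReal.rpow_add_of_nonneg _ _ (by norm_num) (by norm_num)]; norm_num
  have hUc : Continuous (⇑U) := U.continuous
  have hfc : Continuous (⇑f) := f.continuous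
  have hUi : Integrable (⇑U) (volume.prod volume) := U.integrable
  have hfi : Integrable (⇑f) (volume.prod volume) := f.integrable
  let A : ℝ → ℝ → ℂ := fun y τ => ∫ t : ℝ, Complex.exp (Complex.I * ((-1 * (t * τ) : ℝ) : ℂ)) * U (y, t)
  have hAi : ∀ τ, Integrable (fun y => A y τ) := by
    intro τ
    have : Integrable (fun p : ℝ × ℝ => Complex.exp (Complex.I * ((-1 * (p.2 * τ) : ℝ) : ℂ)) * U p)
        (volume.prod volume) :=
      hUi.bdd_mul (c := 1) (Continuous.aestronglyMeasurable (by fun_prop))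
        (Filter.Eventually.of_forall fun p => (norm_exp_I _).le)
    exact this.integral_prod_left
  have hf : ∀ ξ τ, f (ξ, τ) = ∫ y : ℝ, Complex.exp (Complex.I * ((-1 * (y * ξ) : ℝ) : ℂ)) * A y τ := by
    intro ξ τ
    have hi : Integrable (fun p : ℝ × ℝ => Complex.exp (-Complex.I * ((p.1 * ξ + p.2 * τ : ℝ) : ℂ)) * U p)
        (volume.prod volume) := by
      refine hUi.bdd_mul (c := 1) (Continuous.aestronglyMeasurable (by fun_prop))
        (Filter.Eventually.of_forall fun p => ?_)
      rw [neg_mul, ← mul_neg, ← Complex.ofReal_neg]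
      exact (norm_exp_I _).le
    rw [hfU, F2]
    rw [Measure.volume_eq_prod, integral_prod _ hi]
    congr 1; ext y
    rw [← integral_const_mul]
    congr 1; ext t
    rw [← mul_assoc, ← Complex.exp_add]
    congr 2
    push_cast; ring
  have hAm : Measurable (fun p : ℝ × ℝ => A p.1 p.2) := by
    have hc : Continuous (fun z : (ℝ × ℝ) × ℝ =>
      Complex.exp (Complex.I * ((-1 * (z.2 * z.1.2) : ℝ) : ℂ)) * U (z.1.1, z.2)) := by fun_prop
    exact (hc.stronglyMeasurable.integral_prod_right' (ν := volume)).measurable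
  let B : ℝ → ℝ → ℂ := fun x τ => ∫ ξ : ℝ, Complex.exp (Complex.I * ((x * ξ : ℝ) : ℂ)) *
    ((m (ξ, τ) : ℂ) * f (ξ, τ))
  have hB : ∀ x τ, ‖B x τ‖ₑ ≤ ∫⁻ y, ENNReal.ofReal (G (x - y)) * ‖A y τ‖ₑ := by
    intro x τ
    have := conv_bound (fun ξ => (m (ξ, τ) : ℂ)) (fun y => A y τ) (hm τ) (hAi τ) x G (hK τ)
    simp_rw [← hf] at this
    exact this
  have hmf : Integrable (fun q : ℝ × ℝ => (m q : ℂ) * f q) (volume.prod volume) :=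
    hfi.bdd_mul (c := B0) (Continuous.aestronglyMeasurable (by fun_prop))
      (Filter.Eventually.of_forall fun p => by
        rw [Complex.norm_real, Real.norm_eq_abs]; exact hmb p)
  have hBi : ∀ x, Integrable (B x) := by
    intro x
    have : Integrable (fun q : ℝ × ℝ => Complex.exp (Complex.I * ((x * q.1 : ℝ) : ℂ)) *
        ((m q : ℂ) * f q)) (volume.prod volume) :=
      hmf.bdd_mul (c := 1) (Continuous.aestronglyMeasurable (by fun_prop))
        (Filter.Eventually.of_forall fun p => (norm_exp_I _).le)
    exact this.integral_prod_right
  have hv : ∀ x t, F2inv (fun q => (m q : ℂ) * f q) (x, t) =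
      ((((2 * Real.pi) ^ 2 : ℝ)⁻¹ : ℝ) : ℂ) *
      ∫ τ : ℝ, Complex.exp (Complex.I * ((1 * (τ * t) : ℝ) : ℂ)) * B x τ := by
    intro x t
    rw [F2inv]
    congr 1
    have hi : Integrable (fun q : ℝ × ℝ => Complex.exp (Complex.I * ((x * q.1 + t * q.2 : ℝ) : ℂ)) *
        ((m q : ℂ) * f q)) (volume.prod volume) :=
      hmf.bdd_mul (c := 1) (Continuous.aestronglyMeasurable (by fun_prop))
        (Filter.Eventually.of_forall fun p => (norm_exp_I _).le)
    rw [Measure.volume_eq_prod, integral_prod_symm _ hi]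
    congr 1; ext τ
    rw [← integral_const_mul]
    congr 1; ext ξ
    rw [← mul_assoc (Complex.exp _) (Complex.exp _), ← Complex.exp_add]
    congr 2
    push_cast; ring
  have hc0 : ‖((((2 * Real.pi) ^ 2 : ℝ)⁻¹ : ℝ) : ℂ)‖ₑ ≤ 1 := by
    rw [← ofReal_norm, ENNReal.ofReal_le_one, Complex.norm_real, Real.norm_of_nonneg (by positivity)]
    apply inv_le_one_of_one_le₀
    nlinarith [Real.pi_gt_three]
  have hN1 : ∀ x, N2 (fun t => F2inv (fun q => (m q : ℂ) * f q) (x, t)) ≤ P * N2 (B x) := by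
    intro x
    refine le_trans ?_ (N2_plancherel 1 (by norm_num) (B x) (hBi x))
    unfold N2
    gcongr with t
    beta_reduce
    rw [hv, enorm_mul]
    exact mul_le_of_le_one_left' hc0
  have hUs : ∀ y, Integrable (fun t => U (y, t)) := by
    intro y
    obtain ⟨C, hC, h⟩ := schwartz_decay U
    have hi : Integrable (fun t : ℝ => C * (1 + y ^ 2)⁻¹ * (1 + t ^ 2)⁻¹) :=
      integrable_inv_one_add_sq.const_mul _
    refine hi.mono' (Continuous.aestronglyMeasurable (by fun_prop)) (Filter.Eventually.of_forall fun t => ?_)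
    rw [mul_assoc]; exact h y t
  have hN2 : ∀ y, N2 (A y) ≤ P * N2 (fun t => U (y, t)) := fun y =>
    N2_plancherel (-1) (by norm_num) _ (hUs y)
  have hNm : Measurable (fun y => N2 (fun t => U (y, t))) := by
    unfold N2
    apply Measurable.pow_const
    apply Measurable.lintegral_prod_right' (f := fun p : ℝ × ℝ => ‖U (p.1, p.2)‖ₑ ^ 2)
    exact (hUc.measurable.enorm).pow_const 2
  have hN3 : ∀ x, N2 (B x) ≤ ∫⁻ y, ENNReal.ofReal (G (x - y)) * (P * N2 (fun t => U (y, t))) := by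
    intro x
    calc N2 (B x) ≤ (∫⁻ τ, (∫⁻ y, ENNReal.ofReal (G (x - y)) * ‖A y τ‖ₑ) ^ 2) ^ (1 / 2 : ℝ) := by
          unfold N2
          gcongr with τ
          exact hB x τ
      _ ≤ ∫⁻ y, (∫⁻ τ, (ENNReal.ofReal (G (x - y)) * ‖A y τ‖ₑ) ^ 2) ^ (1 / 2 : ℝ) := by
          apply minkowski_two (fun y τ => ENNReal.ofReal (G (x - y)) * ‖A y τ‖ₑ)
          refine Measurable.mul ?_ hAm.enorm
          exact (hG.comp (measurable_const.sub measurable_fst)).ennreal_ofReal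
      _ ≤ _ := by
          gcongr with y
          have hm1 : Measurable (fun τ => ‖A y τ‖ₑ ^ 2) :=
            ((hAm.comp measurable_prodMk_left).enorm).pow_const 2
          simp_rw [mul_pow]
          rw [lintegral_const_mul _ hm1, ENNReal.mul_rpow_of_nonneg _ _ (by norm_num), half_sq]
          gcongr
          exact hN2 y
  calc _ ≤ ∫⁻ x, P * ∫⁻ y, ENNReal.ofReal (G (x - y)) * (P * N2 (fun t => U (y, t))) := by
        gcongr with x
        exact (hN1 x).trans (by gcongr; exact hN3 x)
    _ = P * ∫⁻ x, ∫⁻ y, ENNReal.ofReal (G (x - y)) * (P * N2 (fun t => U (y, t))) := by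
        apply lintegral_const_mul'
        exact ENNReal.rpow_ne_top_of_nonneg (by norm_num) ENNReal.ofReal_ne_top
    _ = P * ((∫⁻ z, ENNReal.ofReal (G z)) * ∫⁻ y, P * N2 (fun t => U (y, t))) := by
        rw [young_lint (fun z => ENNReal.ofReal (G z)) hG.ennreal_ofReal _ (hNm.const_mul P)]
    _ = _ := by
        rw [lintegral_const_mul _ hNm, ← hPP]; ring

theorem modulation_cutoff_L1L2_bound (η₀ : ℝ → ℝ)
    (hη₀ : ContDiff ℝ (⊤ : ℕ∞) η₀) (hη₀e : ∀ ξ, η₀ (-ξ) = η₀ ξ)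
    (hη₀r : ∀ ξ, η₀ ξ ∈ Set.Icc (0 : ℝ) 1)
    (hη₀s : Function.support η₀ ⊆ Set.Icc (-8/5 : ℝ) (8/5))
    (hη₀1 : ∀ ξ ∈ Set.Icc (-(5 : ℝ)/4) (5/4), η₀ ξ = 1) :
    ∃ C : ℝ, 0 < C ∧ ∀ (k j : ℕ), 100 ≤ k → j ≤ k →
      ∀ f : SchwartzMap (ℝ × ℝ) ℂ,
        Function.support (⇑f) ⊆ {p : ℝ × ℝ | p.1 ∈ Idy (k : ℤ)} →
        MixedNorm 1 2
            (fun x t => F2inv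
              (fun q => ((η₀ ((q.2 - ω q.1) / 2 ^ j) : ℝ) : ℂ) * f q) (x, t)) ≤
          C * MixedNorm 1 2 (fun x t => F2inv (⇑f) (x, t)) := by
  obtain ⟨b, hb, hbr, hbs, hb1, hbc⟩ := exists_bump
  obtain ⟨C, hC, hK⟩ := kernel_bound η₀ b hη₀ hη₀r hη₀s hb hbr hbs hbc
  refine ⟨2 * Real.pi * (2 * C * Real.pi) + 1, by positivity, ?_⟩
  intro k j _ hjk f hf
  obtain ⟨U, hU1, hU2⟩ := schwartz_inverse f
  have hL : (0 : ℝ) < 2 ^ k := by positivity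
  have hJ : (0 : ℝ) < 2 ^ j := by positivity
  have hJL : (2 : ℝ) ^ j ≤ (2 ^ k) ^ 2 := by
    rw [← pow_mul]
    exact pow_le_pow_right₀ (by norm_num) (by omega)
  have hηc := hη₀.continuous
  have hbcont := hb.continuous
  let m : ℝ × ℝ → ℝ := fun q => η₀ ((q.2 - ω q.1) / 2 ^ j) * (b (q.1 / 2 ^ k) + b (-q.1 / 2 ^ k))
  have hωc : Continuous ω := by unfold ω; fun_prop
  have hmc : Continuous m := by
    have : Continuous (fun q : ℝ × ℝ =>
      η₀ ((q.2 - ω q.1) / 2 ^ j) * (b (q.1 / 2 ^ k) + b (-q.1 / 2 ^ k))) := by fun_prop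
    exact this
  have hmb : ∀ q, |m q| ≤ 2 := by
    intro q
    have h1 := hη₀r ((q.2 - ω q.1) / 2 ^ j)
    have h2 := hbr (q.1 / 2 ^ k)
    have h3 := hbr (-q.1 / 2 ^ k)
    have h4 : 0 ≤ b (q.1 / 2 ^ k) + b (-q.1 / 2 ^ k) := add_nonneg h2.1 h3.1
    show |η₀ ((q.2 - ω q.1) / 2 ^ j) * (b (q.1 / 2 ^ k) + b (-q.1 / 2 ^ k))| ≤ 2
    rw [abs_of_nonneg (mul_nonneg h1.1 h4)]
    calc _ ≤ 1 * (1 + 1) := mul_le_mul h1.2 (add_le_add h2.2 h3.2) h4 (by norm_num)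
      _ = 2 := by norm_num
  have hkf := fun τ z : ℝ => kernel_full η₀ b hη₀e hηc hbcont hbs hbc C hK (2 ^ k) (2 ^ j) hL hJ hJL τ z
  have hcore := core_bound m f U hU2 hmc 2 hmb
    (fun z => 2 * C * (2 ^ j / 2 ^ k) * (1 + (2 ^ j / 2 ^ k * z) ^ 2)⁻¹) (by fun_prop)
    (fun τ => (hkf τ 0).1) (fun τ z => (hkf τ z).2)
  rw [lint_poisson_scaled _ _ (by positivity) (by positivity)] at hcore
  have hmf : (fun q => ((η₀ ((q.2 - ω q.1) / 2 ^ j) : ℝ) : ℂ) * f q) = fun q => (m q : ℂ) * f q := by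
    ext q
    by_cases hq : f q = 0
    · simp [hq]
    congr 2
    have hq2 : q.1 ∈ Idy (k : ℤ) := hf hq
    obtain ⟨ha, hb2⟩ := hq2
    rw [zpow_sub₀ (by norm_num), zpow_one, zpow_natCast] at ha
    rw [zpow_add₀ (by norm_num), zpow_one, zpow_natCast] at hb2
    have hsum : b (q.1 / 2 ^ k) + b (-q.1 / 2 ^ k) = 1 := by
      rcases le_or_gt q.1 0 with h | h
      · rw [abs_of_nonpos h] at ha hb2
        rw [hbs (q.1 / 2 ^ k), hb1 (-q.1 / 2 ^ k), zero_add]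
        · constructor
          · rw [le_div_iff₀ hL]; linarith
          · rw [div_le_iff₀ hL]; linarith
        · intro hh
          have : q.1 / 2 ^ k ≤ 0 := div_nonpos_of_nonpos_of_nonneg h hL.le
          linarith [hh.1]
      · rw [abs_of_pos h] at ha hb2
        rw [hbs (-q.1 / 2 ^ k), hb1 (q.1 / 2 ^ k), add_zero]
        · constructor
          · rw [le_div_iff₀ hL]; linarith
          · rw [div_le_iff₀ hL]; linarith
        · intro hh
          have : -q.1 / 2 ^ k ≤ 0 := div_nonpos_of_nonpos_of_nonneg (by linarith) hL.le
          linarith [hh.1]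
    show _ = η₀ ((q.2 - ω q.1) / 2 ^ j) * (b (q.1 / 2 ^ k) + b (-q.1 / 2 ^ k))
    rw [hsum, mul_one]
  rw [hmf]
  have hUe : (fun x t => F2inv (⇑f) (x, t)) = fun x t => U (x, t) := by
    ext x t; exact hU1 (x, t)
  obtain ⟨hs1, hs2⟩ := slice_finite U
  rw [hUe, mixed_eq _ hs1]
  refine (mixed_le _ _ ?_ hcore).trans ?_
  · exact ENNReal.mul_ne_top ENNReal.ofReal_ne_top (ENNReal.mul_ne_top ENNReal.ofReal_ne_top hs2)
  · rw [ENNReal.toReal_mul, ENNReal.toReal_mul, ENNReal.toReal_ofReal (by positivity),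
      ENNReal.toReal_ofReal (by positivity)]
    have : 0 ≤ (∫⁻ x, N2 (fun t => U (x, t))).toReal := ENNReal.toReal_nonneg
    nlinarith
end
end

section
/- Let k ≥ 100 be an integer, ω(ξ) = -ξ|ξ|, and χ_{[k-1,k+1]} a smooth cutoff to |ξ| ∈ [2^(k-2), 2^(k+2)]. Then for all x₀ ∈ ℝ and all τ ∈ ℝ, |∫_ℝ e^{i x₀ ξ} χ_{[k-1,k+1]}(ξ) (τ-ω(ξ)+i)^{-1} η_{≤k}(τ-ω(ξ)) dξ| ≤ C 2^{-k}, with C independent of k, x₀, τ. -/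
open MeasureTheory

noncomputable section

lemma sin_osc (x T : ℝ) (hx : 0 < x) (hT : 0 ≤ T) :
    |∫ u in (0:ℝ)..T, Real.sin (x * u) * (u / (u ^ 2 + 1))| ≤ 4 := by
  have hpos : ∀ u : ℝ, u ^ 2 + 1 ≠ 0 := fun u => by positivity
  have hcont : Continuous fun u : ℝ => Real.sin (x * u) * (u / (u ^ 2 + 1)) := by
    fun_prop (disch := intros; exact hpos _)
  have inner : ∀ r : ℝ, 0 ≤ r → r ≤ 1 / x →
      |∫ u in (0:ℝ)..r, Real.sin (x * u) * (u / (u ^ 2 + 1))| ≤ 1 := by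
    intro r hr hrx
    have := intervalIntegral.norm_integral_le_of_norm_le_const (a := 0) (b := r) (C := x)
      (f := fun u : ℝ => Real.sin (x * u) * (u / (u ^ 2 + 1))) (by
        intro u hu
        rw [Real.norm_eq_abs, abs_mul, abs_div, abs_of_pos (by positivity : (0:ℝ) < u^2+1)]
        have h1 : |Real.sin (x * u)| ≤ x * |u| := by
          have := Real.abs_sin_le_abs (x := x * u)
          rwa [abs_mul, abs_of_pos hx] at this
        calc _ ≤ (x * |u|) * (|u| / (u^2+1)) := by gcongr
          _ = x * (u^2 / (u^2+1)) := by rw [← sq_abs]; ring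
          _ ≤ x * 1 := by
            gcongr
            rw [div_le_one (by positivity)]; linarith
          _ = x := mul_one x)
    rw [Real.norm_eq_abs, sub_zero, abs_of_nonneg hr] at this
    refine this.trans ?_
    rw [le_div_iff₀ hx] at hrx
    linarith
  by_cases hTx : T ≤ 1 / x
  · linarith [inner T hT hTx]
  push Not at hTx
  set r := 1 / x with hr
  have hr0 : 0 < r := by positivity
  have hxr : x * r = 1 := by rw [hr]; field_simp
  rw [← intervalIntegral.integral_add_adjacent_intervals (hcont.intervalIntegrable 0 r)
    (hcont.intervalIntegrable r T)]
  have h1 := inner r hr0.le le_rfl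
  have hIBP := intervalIntegral.integral_mul_deriv_eq_deriv_mul (a := r) (b := T)
    (u := fun u : ℝ => u / (u^2+1)) (v := fun u => - Real.cos (x * u) / x)
    (u' := fun u => (1 - u^2) / (u^2+1)^2) (v' := fun u => Real.sin (x * u))
    (by
      intro u _
      have := (hasDerivAt_id u).div (((hasDerivAt_id u).pow 2).add_const 1) (by simpa using hpos u)
      refine this.congr_deriv ?_
      simp; ring)
    (by
      intro u _
      have := (((hasDerivAt_id u).const_mul x).cos.neg).div_const x
      refine this.congr_deriv ?_
      simp; field_simp)
    (by
      apply Continuous.intervalIntegrable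
      fun_prop (disch := intros; exact pow_ne_zero _ (hpos _)))
    (by
      apply Continuous.intervalIntegrable
      fun_prop)
  have h2 : |∫ u in r..T, Real.sin (x * u) * (u / (u ^ 2 + 1))| ≤ 3 := by
    simp_rw [mul_comm (Real.sin _)]
    rw [hIBP]
    have hg : ∀ u, r ≤ u → |u / (u^2+1) * (-Real.cos (x*u) / x)| ≤ 1 := by
      intro u hu
      have hu0 : 0 < u := by linarith
      rw [abs_mul, abs_div (-_), abs_neg, abs_of_pos hx, abs_of_pos (by positivity : 0 < u/(u^2+1))]
      have hc := Real.abs_cos_le_one (x*u)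
      have hq : u / (u^2+1) ≤ 1 / u := by
        rw [div_le_div_iff₀ (by positivity) hu0]; nlinarith
      calc _ ≤ (1/u) * (1 / x) := by
            exact mul_le_mul hq (by gcongr) (by positivity) (by positivity)
        _ = 1 / (x * u) := by field_simp
        _ ≤ 1 := by
          rw [div_le_one (by positivity), ← hxr]; gcongr
    have hint : |∫ u in r..T, (1 - u^2) / (u^2+1)^2 * (-Real.cos (x*u) / x)| ≤ 1 := by
      have hev : ∫ u in r..T, (1 / x) * (u^2)⁻¹ = (1/x) * (1/r - 1/T) := by
        rw [intervalIntegral.integral_const_mul]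
        congr 1
        have := intervalIntegral.integral_eq_sub_of_hasDerivAt (a := r) (b := T)
          (f := fun u : ℝ => - u⁻¹) (f' := fun u => (u^2)⁻¹) (by
            intro u hu
            rw [Set.uIcc_of_le hTx.le] at hu
            have := (hasDerivAt_inv (x := u) (by linarith [hu.1])).neg
            refine HasDerivAt.congr_deriv this ?_
            simp) (by
            apply ContinuousOn.intervalIntegrable
            rw [Set.uIcc_of_le hTx.le]
            intro u hu
            have : u ≠ 0 := by linarith [hu.1]
            apply ContinuousAt.continuousWithinAt
            fun_prop (disch := simpa using this))
        rw [this]; ring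
      have := intervalIntegral.norm_integral_le_of_norm_le (μ := volume) (a := r) (b := T)
        (f := fun u : ℝ => (1 - u^2) / (u^2+1)^2 * (-Real.cos (x*u) / x))
        (g := fun u => (1/x) * (u^2)⁻¹) hTx.le (by
          refine Filter.Eventually.of_forall fun u hu => ?_
          have hu0 : 0 < u := by linarith [hu.1]
          rw [Real.norm_eq_abs, abs_mul, abs_div (-_), abs_neg, abs_of_pos hx, abs_div, abs_of_pos (by positivity : 0 < (u^2+1)^2), mul_comm]
          have hc := Real.abs_cos_le_one (x*u)
          gcongr
          rw [inv_eq_one_div, div_le_div_iff₀ (by positivity) (by positivity)]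
          have : |1 - u^2| ≤ u^2+1 := by rw [abs_le]; constructor <;> nlinarith
          nlinarith [mul_le_mul_of_nonneg_right this (sq_nonneg u), sq_nonneg u]) (by
            apply ContinuousOn.intervalIntegrable
            rw [Set.uIcc_of_le hTx.le]
            intro u hu
            have : u ≠ 0 := by linarith [hu.1]
            apply ContinuousAt.continuousWithinAt
            fun_prop (disch := simpa using this))
      rw [hev, Real.norm_eq_abs] at this
      refine this.trans ?_
      have h3 : 1/x * (1/r) = 1 := by rw [hr]; field_simp
      have hT0 : 0 < T := by linarith
      have : 0 ≤ 1/x * (1/T) := by positivity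
      linarith
    have ha := abs_le.1 (hg T hTx.le)
    have hb := abs_le.1 (hg r le_rfl)
    have hc := abs_le.1 hint
    rw [abs_le]; constructor <;> linarith
  exact (abs_add_le _ _).trans (by linarith)

lemma sin_osc' (x T : ℝ) (hT : 0 ≤ T) :
    |∫ u in (0:ℝ)..T, Real.sin (x * u) * (u / (u ^ 2 + 1))| ≤ 4 := by
  rcases lt_trichotomy x 0 with h | h | h
  · have := sin_osc (-x) T (by linarith) hT
    simpa [Real.sin_neg, neg_mul] using this
  · subst h; simp
  · exact sin_osc x T h hT

lemma ker_ne (b s : ℝ) : ((b * s : ℝ) : ℂ) + Complex.I ≠ 0 := by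
  intro h
  have := congrArg Complex.im h
  simp at this

lemma real_ne (s : ℝ) : (s : ℂ) + Complex.I ≠ 0 := by
  intro h
  have := congrArg Complex.im h
  simp at this

lemma ker_one (x T : ℝ) (hT : 0 ≤ T) :
    ‖∫ u in (-T)..T, Complex.exp (Complex.I * ((x * u : ℝ) : ℂ)) * ((u : ℂ) + Complex.I)⁻¹‖ ≤ 12 := by
  have hpos : ∀ u : ℝ, u ^ 2 + 1 ≠ 0 := fun u => by positivity
  set F : ℝ → ℂ := fun u => Complex.exp (Complex.I * ((x * u : ℝ) : ℂ)) * ((u : ℂ) + Complex.I)⁻¹ with hF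
  have hFc : Continuous F := by
    rw [hF]; fun_prop (disch := intros; exact real_ne _)
  have hi := fun a b => hFc.intervalIntegrable (μ := volume) a b
  rw [← intervalIntegral.integral_add_adjacent_intervals (hi (-T) 0) (hi 0 T)]
  have hneg : ∫ u in (-T)..0, F u = ∫ u in (0:ℝ)..T, F (-u) := by
    simp
  have hin : IntervalIntegrable (fun u => F (-u)) volume 0 T :=
    (hFc.comp continuous_neg).intervalIntegrable _ _
  rw [hneg, ← intervalIntegral.integral_add hin (hi 0 T)]
  have key : ∀ u : ℝ, F (-u) + F u = (2 * Complex.I) *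
      ((Real.sin (x * u) * (u / (u ^ 2 + 1)) - Real.cos (x * u) * (1 + u^2)⁻¹ : ℝ) : ℂ) := by
    intro u
    have e1 : Complex.exp (Complex.I * ((x * u : ℝ) : ℂ)) = Complex.cos ((x*u:ℝ):ℂ) + Complex.sin ((x*u:ℝ):ℂ) * Complex.I := by
      rw [mul_comm, Complex.exp_mul_I]
    have e2 : Complex.exp (Complex.I * ((x * -u : ℝ) : ℂ)) = Complex.cos ((x*u:ℝ):ℂ) - Complex.sin ((x*u:ℝ):ℂ) * Complex.I := by
      rw [mul_comm, Complex.exp_mul_I]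
      rw [mul_neg, Complex.ofReal_neg, Complex.cos_neg, Complex.sin_neg]; ring
    have n1 := real_ne u
    have n2 := real_ne (-u)
    have n3 : ((u:ℂ)^2 + 1) ≠ 0 := by exact_mod_cast hpos u
    have n4 : (1 + (u:ℂ)^2) ≠ 0 := by rwa [add_comm]
    have i1 : ((u : ℂ) + Complex.I)⁻¹ = ((u:ℂ) - Complex.I) * ((u:ℂ)^2+1)⁻¹ := by
      field_simp
      ring_nf; simp; ring
    have i2 : (((-u : ℝ) : ℂ) + Complex.I)⁻¹ = (-(u:ℂ) - Complex.I) * ((u:ℂ)^2+1)⁻¹ := by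
      field_simp
      push_cast
      ring_nf; simp; ring
    simp only [hF]
    rw [e1, e2, i1, i2]
    push_cast
    rw [add_comm (1:ℂ), div_eq_mul_inv]
    ring_nf
    try simp
    try ring
  simp_rw [key]
  rw [intervalIntegral.integral_const_mul, intervalIntegral.integral_ofReal, norm_mul, Complex.norm_real,
    intervalIntegral.integral_sub (by
      apply Continuous.intervalIntegrable
      fun_prop (disch := intros; exact hpos _)) (by
      apply Continuous.intervalIntegrable
      have : ∀ u : ℝ, 1 + u ^ 2 ≠ 0 := fun u => by positivity
      fun_prop (disch := intros; exact this _))]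
  have h1 := sin_osc' x T hT
  have h2 : ‖∫ u in (0:ℝ)..T, Real.cos (x * u) * (1 + u^2)⁻¹‖ ≤ 2 := by
    have := intervalIntegral.norm_integral_le_of_norm_le (μ := volume) (a := 0) (b := T)
      (f := fun u : ℝ => Real.cos (x * u) * (1 + u^2)⁻¹) (g := fun u => (1+u^2)⁻¹) hT (by
        refine Filter.Eventually.of_forall fun u hu => ?_
        rw [norm_mul, Real.norm_eq_abs, Real.norm_eq_abs, abs_of_pos (by positivity : 0 < (1+u^2)⁻¹)]
        exact mul_le_of_le_one_left (by positivity) (Real.abs_cos_le_one _)) (by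
        apply Continuous.intervalIntegrable
        have : ∀ u : ℝ, 1 + u ^ 2 ≠ 0 := fun u => by positivity
        fun_prop (disch := intros; exact this _))
    rw [integral_inv_one_add_sq] at this
    have h3 := Real.arctan_lt_pi_div_two T
    have h4 := Real.pi_lt_four
    simp only [Real.arctan_zero] at this
    linarith
  have h3 := norm_sub_le (∫ u in (0:ℝ)..T, Real.sin (x * u) * (u / (u ^ 2 + 1))) (∫ u in (0:ℝ)..T, Real.cos (x * u) * (1 + u^2)⁻¹)
  rw [Real.norm_eq_abs (∫ u in (0:ℝ)..T, Real.sin (x * u) * (u / (u ^ 2 + 1)))] at h3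
  have h4 : ‖(2 * Complex.I)‖ = 2 := by simp
  rw [h4]
  linarith

lemma ker_b (x b R : ℝ) (hb : 0 < b) (hR : 0 ≤ R) :
    ‖∫ s in (-R)..R, Complex.exp (Complex.I * ((x * s : ℝ) : ℂ)) * (((b * s : ℝ) : ℂ) + Complex.I)⁻¹‖ ≤ 12 / b := by
  have h := ker_one (x / b) (b * R) (by positivity)
  have h2 := intervalIntegral.integral_comp_mul_left (a := -R) (b := R)
    (f := fun u : ℝ => Complex.exp (Complex.I * ((x / b * u : ℝ) : ℂ)) * ((u : ℂ) + Complex.I)⁻¹) hb.ne'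
  have h3 : ∀ s : ℝ, x / b * (b * s) = x * s := fun s => by field_simp
  simp only [h3] at h2
  rw [h2, norm_smul, mul_neg, Real.norm_eq_abs, abs_of_pos (by positivity), div_eq_inv_mul 12 b]
  exact mul_le_mul_of_nonneg_left h (inv_nonneg.2 hb.le)

/-- elementary facts about `ξ|ξ|`. -/
lemma quad_lower (p s : ℝ) : |p| * |s| / 2 ≤ abs ((p + s) * |p + s| - p * |p|) := by
  rcases abs_cases p with ⟨h1, h2⟩ | ⟨h1, h2⟩ <;> rcases abs_cases s with ⟨h3, h4⟩ | ⟨h3, h4⟩ <;>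
  rcases abs_cases (p + s) with ⟨h5, h6⟩ | ⟨h5, h6⟩ <;> rw [h1, h3, h5] <;>
  first
    | (refine le_trans ?_ (le_abs_self _); nlinarith [mul_nonneg h2 h4, sq_nonneg (p+s), sq_nonneg p, sq_nonneg s, sq_nonneg (p + 2 * s)]; done)
    | (refine le_trans ?_ (neg_le_abs _); nlinarith [sq_nonneg (p+s), sq_nonneg p, sq_nonneg s, sq_nonneg (p + 2 * s)]; done)
    | (refine le_trans ?_ (le_abs_self _); nlinarith [sq_nonneg (p+s), sq_nonneg p, sq_nonneg s, sq_nonneg (p + 2 * s)]; done)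
    | (refine le_trans ?_ (neg_le_abs _); nlinarith [mul_nonneg h2 h6, sq_nonneg (p+s)]; done)

lemma quad_taylor (p s : ℝ) : abs ((p + s) * |p + s| - p * |p| - 2 * |p| * s) ≤ s ^ 2 := by
  rw [abs_le]
  rcases abs_cases p with ⟨h1, h2⟩ | ⟨h1, h2⟩ <;> 
  rcases abs_cases (p + s) with ⟨h5, h6⟩ | ⟨h5, h6⟩ <;> rw [h1, h5] <;> constructor <;>
  nlinarith [sq_nonneg (p+s), sq_nonneg p, sq_nonneg s]

lemma norm_real_add_I_ge (m : ℝ) : |m| ≤ ‖(m : ℂ) + Complex.I‖ := by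
  have := Complex.abs_re_le_norm ((m : ℂ) + Complex.I)
  simpa using this

/-- The pointwise comparison. -/
lemma pointwise (A A0 m b s E N D1 D2 : ℝ) (hN : 1 ≤ N) (hb : N / 4 ≤ b)
    (hA0 : |A0| ≤ 1) (hD1 : 0 ≤ D1) (hD2 : 0 ≤ D2)
    (hA : |A - A0| ≤ D1 * |s| / N + D2 * |m| / N)
    (hm : b * |s| / 4 ≤ |m|) (hmt : |m - b * s| ≤ s ^ 2)
    (h0 : s = 0 → m = 0)
    (hE : E = (16 * D1 + D2 + 64) / N) :
    ‖(A : ℂ) * ((m : ℂ) + Complex.I)⁻¹ - (A0 : ℂ) * (((b * s : ℝ) : ℂ) + Complex.I)⁻¹‖ ≤ E := by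
  have hN0 : 0 < N := by linarith
  have hb0 : 0 < b := by linarith
  have hE0 : 0 ≤ E := by rw [hE]; positivity
  by_cases hs : s = 0
  · have hm0 := h0 hs
    subst hs
    subst hm0
    have : |A - A0| ≤ 0 := by simpa using hA
    have : A = A0 := by linarith [abs_nonpos_iff.1 this]
    subst this
    simpa using hE0
  have hs0 : 0 < |s| := abs_pos.2 hs
  have hm0 : 0 < |m| := lt_of_lt_of_le (by positivity) hm
  have n1 := real_ne m
  have n2 := real_ne (b * s)
  have g1 := norm_real_add_I_ge m
  have g2 := norm_real_add_I_ge (b * s)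
  rw [abs_mul, abs_of_pos hb0] at g2
  have split : (A : ℂ) * ((m : ℂ) + Complex.I)⁻¹ - (A0 : ℂ) * (((b * s : ℝ) : ℂ) + Complex.I)⁻¹
      = ((A - A0 : ℝ) : ℂ) * ((m : ℂ) + Complex.I)⁻¹
        + (A0 : ℂ) * (-((m - b * s : ℝ) : ℂ) * (((m : ℂ) + Complex.I)⁻¹ * (((b * s : ℝ) : ℂ) + Complex.I)⁻¹)) := by
    have : ((m : ℂ) + Complex.I)⁻¹ - (((b * s : ℝ) : ℂ) + Complex.I)⁻¹ =
      -((m - b * s : ℝ) : ℂ) * (((m : ℂ) + Complex.I)⁻¹ * (((b * s : ℝ) : ℂ) + Complex.I)⁻¹) := by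
      rw [inv_sub_inv n1 n2]
      field_simp
      push_cast
      ring
    rw [← this]
    push_cast
    ring
  rw [split]
  have hbs : N / 16 * |s| ≤ |m| := by
    refine le_trans ?_ hm
    nlinarith
  have t1 : ‖((A - A0 : ℝ) : ℂ) * ((m : ℂ) + Complex.I)⁻¹‖ ≤ (16 * D1 + D2) / N := by
    rw [norm_mul, norm_inv, Complex.norm_real, Real.norm_eq_abs, ← div_eq_mul_inv]
    rw [div_le_div_iff₀ (by positivity) hN0]
    have h1 : |A - A0| * N ≤ D1 * |s| + D2 * |m| := by
      have := mul_le_mul_of_nonneg_right hA hN0.le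
      have e : (D1 * |s| / N + D2 * |m| / N) * N = D1 * |s| + D2 * |m| := by field_simp
      linarith
    have h2 : |s| ≤ 16 * |m| := by nlinarith
    have h3 : D1 * |s| ≤ D1 * (16 * |m|) := by gcongr
    calc _ ≤ _ := h1
      _ ≤ (16 * D1 + D2) * |m| := by linarith
      _ ≤ _ := by gcongr
  have t2 : ‖(A0 : ℂ) * (-((m - b * s : ℝ) : ℂ) * (((m : ℂ) + Complex.I)⁻¹ * (((b * s : ℝ) : ℂ) + Complex.I)⁻¹))‖ ≤ 64 / N := by
    rw [norm_mul, norm_mul, norm_mul, norm_inv, norm_inv, norm_neg, Complex.norm_real, Complex.norm_real,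
      Real.norm_eq_abs, Real.norm_eq_abs, ← mul_inv]
    have hprod : (b * |s| / 4) * (b * |s|) ≤ ‖(m : ℂ) + Complex.I‖ * ‖((b * s : ℝ) : ℂ) + Complex.I‖ := by
      gcongr
      exact hm.trans g1
    calc _ ≤ 1 * (s ^ 2 * ((b * |s| / 4) * (b * |s|))⁻¹) := by gcongr
      _ = 4 / b ^ 2 := by
        rw [← sq_abs s]; field_simp
      _ ≤ 64 / N := by
        rw [div_le_div_iff₀ (by positivity) hN0]
        nlinarith
  calc _ ≤ _ := norm_add_le _ _
    _ ≤ (16 * D1 + D2) / N + 64 / N := add_le_add t1 t2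
    _ = E := by rw [hE]; ring

lemma exists_root (τ : ℝ) : ∃ p : ℝ, τ = -(p * |p|) := by
  rcases le_total 0 τ with h | h
  · refine ⟨-Real.sqrt τ, ?_⟩
    rw [abs_neg, abs_of_nonneg (Real.sqrt_nonneg _)]
    nlinarith [Real.mul_self_sqrt h]
  · refine ⟨Real.sqrt (-τ), ?_⟩
    rw [abs_of_nonneg (Real.sqrt_nonneg _), Real.mul_self_sqrt (by linarith)]
    ring

lemma core (η₀ : ℝ → ℝ) (hc : Continuous η₀) (M : ℝ) (hM : 0 ≤ M)
    (hLip : ∀ a b, |η₀ a - η₀ b| ≤ M * |a - b|)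
    (hη₀r : ∀ ξ, η₀ ξ ∈ Set.Icc (0 : ℝ) 1)
    (hz : ∀ ξ, 8 / 5 < |ξ| → η₀ ξ = 0)
    (h1 : ∀ ξ, |ξ| ≤ 5 / 4 → η₀ ξ = 1)
    (N : ℝ) (hN : 100 ≤ N) (x p : ℝ) :
    ‖∫ ξ : ℝ, Complex.exp (Complex.I * ((x * ξ : ℝ) : ℂ)) *
        ((η₀ (ξ / (2 * N)) - η₀ (ξ / (N / 4)) : ℝ) : ℂ) *
        (((ξ * |ξ| - p * |p| : ℝ) : ℂ) + Complex.I)⁻¹ *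
        ((η₀ ((ξ * |ξ| - p * |p|) / N) : ℝ) : ℂ)‖ ≤ ((16 * (5 * M) + M + 64) * 52 + 48) / N := by
  have hN0 : 0 < N := by linarith
  set X : ℝ → ℝ := fun ξ => η₀ (ξ / (2 * N)) - η₀ (ξ / (N / 4)) with hX
  set m : ℝ → ℝ := fun s => (p + s) * |p + s| - p * |p| with hm
  by_cases hp : |p| < N / 8
  · -- the integrand vanishes
    have : ∀ ξ : ℝ, Complex.exp (Complex.I * ((x * ξ : ℝ) : ℂ)) *
        ((X ξ : ℝ) : ℂ) * (((ξ * |ξ| - p * |p| : ℝ) : ℂ) + Complex.I)⁻¹ *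
        ((η₀ ((ξ * |ξ| - p * |p|) / N) : ℝ) : ℂ) = 0 := by
      intro ξ
      by_cases hξ : |ξ| ≤ 5 / 16 * N
      · have : X ξ = 0 := by
          simp only [hX]
          rw [h1 _ ?_, h1 _ ?_, sub_self]
          · rw [abs_div, abs_of_pos (by positivity : 0 < N / 4), div_le_iff₀ (by positivity)]; linarith
          · rw [abs_div, abs_of_pos (by positivity : 0 < 2 * N), div_le_iff₀ (by positivity)]; linarith
        rw [this]; simp
      · push Not at hξ
        have : η₀ ((ξ * |ξ| - p * |p|) / N) = 0 := by
          apply hz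
          rw [abs_div, abs_of_pos hN0, lt_div_iff₀ hN0]
          have e1 := abs_sub_abs_le_abs_sub (ξ * |ξ|) (p * |p|)
          rw [abs_mul, abs_mul, abs_abs, abs_abs] at e1
          have := abs_nonneg p
          nlinarith
        rw [this]; simp
    have h0 : (fun ξ : ℝ => Complex.exp (Complex.I * ((x * ξ : ℝ) : ℂ)) *
        ((X ξ : ℝ) : ℂ) * (((ξ * |ξ| - p * |p| : ℝ) : ℂ) + Complex.I)⁻¹ *
        ((η₀ ((ξ * |ξ| - p * |p|) / N) : ℝ) : ℂ)) = fun _ => 0 := funext this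
    change ‖∫ ξ : ℝ, (fun ξ : ℝ => Complex.exp (Complex.I * ((x * ξ : ℝ) : ℂ)) *
        ((X ξ : ℝ) : ℂ) * (((ξ * |ξ| - p * |p| : ℝ) : ℂ) + Complex.I)⁻¹ *
        ((η₀ ((ξ * |ξ| - p * |p|) / N) : ℝ) : ℂ)) ξ‖ ≤ _
    rw [h0]
    simp only [integral_zero, norm_zero]
    positivity
  push Not at hp
  set b : ℝ := 2 * |p| with hb
  have hbN : N / 4 ≤ b := by linarith
  have hb0 : 0 < b := by linarith
  set A : ℝ → ℝ := fun s => X (p + s) * η₀ (m s / N) with hA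
  set f : ℝ → ℂ := fun ξ => Complex.exp (Complex.I * ((x * ξ : ℝ) : ℂ)) *
        ((X ξ : ℝ) : ℂ) * (((ξ * |ξ| - p * |p| : ℝ) : ℂ) + Complex.I)⁻¹ *
        ((η₀ ((ξ * |ξ| - p * |p|) / N) : ℝ) : ℂ) with hf
  have hfs : ∀ s, f (p + s) = Complex.exp (Complex.I * ((x * p : ℝ) : ℂ)) *
      (Complex.exp (Complex.I * ((x * s : ℝ) : ℂ)) * ((A s : ℂ) * ((m s : ℂ) + Complex.I)⁻¹)) := by
    intro s
    simp only [hf, hA, hm]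
    rw [mul_add, Complex.ofReal_add, mul_add, Complex.exp_add]
    push_cast
    ring
  change ‖∫ ξ : ℝ, f ξ‖ ≤ _
  rw [← integral_add_left_eq_self f p]
  simp_rw [hfs]
  rw [integral_const_mul, norm_mul]
  have hexp : ∀ y : ℝ, ‖Complex.exp (Complex.I * (y : ℂ))‖ = 1 := fun y => by
    rw [mul_comm]; exact Complex.norm_exp_ofReal_mul_I y
  rw [hexp, one_mul]
  have hml : ∀ s, b * |s| / 4 ≤ |m s| := fun s => by
    have := quad_lower p s
    simp only [hm, hb]; linarith
  have hsupp : Function.support (fun s : ℝ => Complex.exp (Complex.I * ((x * s : ℝ) : ℂ)) *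
      ((A s : ℂ) * ((m s : ℂ) + Complex.I)⁻¹)) ⊆ Set.Ioc (-26) 26 := by
    intro s hs
    by_contra hcon
    apply hs
    have hs26 : 26 ≤ |s| := by
      by_contra h
      push Not at h
      rw [abs_lt] at h
      exact hcon ⟨h.1, h.2.le⟩
    have : A s = 0 := by
      simp only [hA]
      rw [hz (m s / N), mul_zero]
      rw [abs_div, abs_of_pos hN0, lt_div_iff₀ hN0]
      have := hml s
      nlinarith
    simp [this]
  rw [← intervalIntegral.integral_eq_integral_of_support_subset hsupp]
  have hXc : Continuous X := by
    simp only [hX]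
    exact (hc.comp (continuous_id.div_const _)).sub (hc.comp (continuous_id.div_const _))
  have hmc : Continuous m := by simp only [hm]; fun_prop
  have hAc : Continuous A := by
    simp only [hA]
    exact (hXc.comp (by fun_prop)).mul (hc.comp (hmc.div_const _))
  have hec : Continuous fun s : ℝ => Complex.exp (Complex.I * ((x * s : ℝ) : ℂ)) := by fun_prop
  set G : ℝ → ℂ := fun s => Complex.exp (Complex.I * ((x * s : ℝ) : ℂ)) *
      ((A s : ℂ) * ((m s : ℂ) + Complex.I)⁻¹) with hG
  set K : ℝ → ℂ := fun s => Complex.exp (Complex.I * ((x * s : ℝ) : ℂ)) * (((b * s : ℝ) : ℂ) + Complex.I)⁻¹ with hK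
  have hGc : Continuous G := by
    refine hec.mul ((Complex.continuous_ofReal.comp hAc).mul (Continuous.inv₀ ?_ fun s => real_ne _))
    exact (Complex.continuous_ofReal.comp hmc).add continuous_const
  have hKc : Continuous K := by
    refine hec.mul (Continuous.inv₀ ?_ fun s => real_ne _)
    fun_prop
  have hXabs : ∀ ξ, |X ξ| ≤ 1 := fun ξ => by
    have a1 := hη₀r (ξ / (2 * N))
    have a2 := hη₀r (ξ / (N / 4))
    simp only [hX]
    rw [abs_le]; constructor <;> linarith [a1.1, a1.2, a2.1, a2.2]
  have hm00 : m 0 = 0 := by simp [hm]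
  have hη0 : η₀ 0 = 1 := h1 0 (by norm_num)
  have hA00 : A 0 = X p := by simp [hA, hm00, hη0]
  have hXL : ∀ s, |X (p + s) - X p| ≤ 5 * M * |s| / N := by
    intro s
    have l1 := hLip ((p + s) / (2 * N)) (p / (2 * N))
    have l2 := hLip ((p + s) / (N / 4)) (p / (N / 4))
    have e1 : (p + s) / (2 * N) - p / (2 * N) = s / (2 * N) := by ring
    have e2 : (p + s) / (N / 4) - p / (N / 4) = s / (N / 4) := by ring
    rw [e1, abs_div, abs_of_pos (by positivity : 0 < 2 * N)] at l1
    rw [e2, abs_div, abs_of_pos (by positivity : 0 < N / 4)] at l2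
    have e3 : M * (|s| / (2 * N)) + M * (|s| / (N / 4)) = 9 / 2 * (M * |s| / N) := by
      field_simp; norm_num
    have e4 : 5 * M * |s| / N = 5 * (M * |s| / N) := by ring
    have e5 : 0 ≤ M * |s| / N := by positivity
    simp only [hX]
    calc _ = |(η₀ ((p + s) / (2 * N)) - η₀ (p / (2 * N))) - (η₀ ((p + s) / (N / 4)) - η₀ (p / (N / 4)))| := by
          congr 1; ring
      _ ≤ _ := abs_sub _ _
      _ ≤ _ := by linarith
  have hAL : ∀ s, |A s - A 0| ≤ 5 * M * |s| / N + M * |m s| / N := by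
    intro s
    rw [hA00]
    have e : A s - X p = (X (p + s) - X p) * η₀ (m s / N) + X p * (η₀ (m s / N) - η₀ 0) := by
      simp only [hA]; rw [hη0]; ring
    have l := hLip (m s / N) 0
    rw [sub_zero, abs_div, abs_of_pos hN0] at l
    have q := hη₀r (m s / N)
    rw [e]
    refine (abs_add_le _ _).trans ?_
    rw [abs_mul, abs_mul, abs_of_nonneg q.1]
    have r1 : |X (p + s) - X p| * η₀ (m s / N) ≤ 5 * M * |s| / N :=
      (mul_le_of_le_one_right (abs_nonneg _) q.2).trans (hXL s)
    have r2 : |X p| * |η₀ (m s / N) - η₀ 0| ≤ M * |m s| / N := by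
      refine (mul_le_of_le_one_left (abs_nonneg _) (hXabs p)).trans ?_
      rw [mul_div_assoc]; exact l
    linarith
  have hpt : ∀ s, ‖G s - (A 0 : ℂ) * K s‖ ≤ (16 * (5 * M) + M + 64) / N := by
    intro s
    have e : G s - (A 0 : ℂ) * K s = Complex.exp (Complex.I * ((x * s : ℝ) : ℂ)) *
      ((A s : ℂ) * ((m s : ℂ) + Complex.I)⁻¹ - (A 0 : ℂ) * (((b * s : ℝ) : ℂ) + Complex.I)⁻¹) := by
      simp only [hG, hK]; ring
    rw [e, norm_mul, hexp, one_mul]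
    refine pointwise (A s) (A 0) (m s) b s _ N (5 * M) M (by linarith) hbN (by rw [hA00]; exact hXabs p)
      (by positivity) hM (hAL s) (hml s) (quad_taylor p s) ?_ rfl
    rintro rfl; exact hm00
  have hsplit : ∫ s in (-26:ℝ)..26, G s = (∫ s in (-26:ℝ)..26, (G s - (A 0 : ℂ) * K s)) +
      (A 0 : ℂ) * ∫ s in (-26:ℝ)..26, K s := by
    rw [← intervalIntegral.integral_const_mul, ← intervalIntegral.integral_add]
    · congr 1; ext s; ring
    · exact (hGc.sub (continuous_const.mul hKc)).intervalIntegrable _ _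
    · exact (continuous_const.mul hKc).intervalIntegrable _ _
  rw [hsplit]
  have b1 := intervalIntegral.norm_integral_le_of_norm_le_const (a := -26) (b := 26)
    (f := fun s => G s - (A 0 : ℂ) * K s) (fun s _ => hpt s)
  have b2 : ‖∫ s in (-26:ℝ)..26, K s‖ ≤ 48 / N := by
    refine (ker_b x b 26 hb0 (by norm_num)).trans ?_
    rw [div_le_div_iff₀ hb0 hN0]; linarith
  have b3 : ‖(A 0 : ℂ) * ∫ s in (-26:ℝ)..26, K s‖ ≤ 48 / N := by
    rw [norm_mul, Complex.norm_real, Real.norm_eq_abs]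
    refine (mul_le_of_le_one_left (norm_nonneg _) ?_).trans b2
    rw [hA00]; exact hXabs p
  refine (norm_add_le _ _).trans ((add_le_add b1 b3).trans (le_of_eq ?_))
  norm_num
  ring

theorem kernel_integral_bound (η₀ : ℝ → ℝ)
    (hη₀ : ContDiff ℝ (⊤ : ℕ∞) η₀) (hη₀e : ∀ ξ, η₀ (-ξ) = η₀ ξ)
    (hη₀r : ∀ ξ, η₀ ξ ∈ Set.Icc (0 : ℝ) 1)
    (hη₀s : Function.support η₀ ⊆ Set.Icc (-8/5 : ℝ) (8/5))
    (hη₀1 : ∀ ξ ∈ Set.Icc (-(5 : ℝ)/4) (5/4), η₀ ξ = 1) :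
    ∃ C : ℝ, 0 < C ∧ ∀ k : ℕ, 100 ≤ k → ∀ x₀ τ : ℝ,
      ‖∫ ξ : ℝ, Complex.exp (Complex.I * ((x₀ * ξ : ℝ) : ℂ)) *
          ((chi η₀ ((k : ℤ) - 1) ξ + chi η₀ (k : ℤ) ξ + chi η₀ ((k : ℤ) + 1) ξ : ℝ) : ℂ) *
          (((τ - ω ξ : ℝ) : ℂ) + Complex.I)⁻¹ *
          ((η₀ ((τ - ω ξ) / 2 ^ (k : ℤ)) : ℝ) : ℂ)‖ ≤
        C * (2 : ℝ) ^ (-(k : ℤ)) := by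
  have hz : ∀ ξ, 8 / 5 < |ξ| → η₀ ξ = 0 := by
    intro ξ hξ
    by_contra h
    have := hη₀s h
    have h2 : |ξ| ≤ 8 / 5 := abs_le.2 ⟨by linarith [this.1], this.2⟩
    linarith
  have h1 : ∀ ξ, |ξ| ≤ 5 / 4 → η₀ ξ = 1 := by
    intro ξ hξ
    rw [abs_le] at hξ
    exact hη₀1 ξ ⟨by linarith [hξ.1], hξ.2⟩
  obtain ⟨M, hM⟩ := ContDiff.lipschitzWith_of_hasCompactSupport
    (HasCompactSupport.of_support_subset_isCompact isCompact_Icc hη₀s) hη₀ (by simp)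
  have hLip : ∀ a b, |η₀ a - η₀ b| ≤ (M : ℝ) * |a - b| := fun a b => by
    have := hM.dist_le_mul a b
    simpa [Real.dist_eq] using this
  have hM0 : (0 : ℝ) ≤ M := M.2
  refine ⟨(16 * (5 * (M : ℝ)) + M + 64) * 52 + 48, by positivity, ?_⟩
  intro k hk x₀ τ
  obtain ⟨p, rfl⟩ := exists_root τ
  have hN : (100 : ℝ) ≤ 2 ^ (k : ℤ) := by
    rw [zpow_natCast]
    calc (100 : ℝ) ≤ 2 ^ 100 := by norm_num
      _ ≤ 2 ^ k := pow_le_pow_right₀ (by norm_num) hk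
  have key := core η₀ hη₀.continuous M hM0 hLip hη₀r hz h1 (2 ^ (k : ℤ)) hN x₀ p
  rw [zpow_neg, ← div_eq_mul_inv]
  refine le_trans (le_of_eq ?_) key
  congr 2
  ext ξ
  have e1 : (2 : ℝ) ^ ((k : ℤ) + 1) = 2 * 2 ^ (k : ℤ) := by
    rw [zpow_add₀ (by norm_num)]; ring
  have e2 : (2 : ℝ) ^ ((k : ℤ) - 1 - 1) = 2 ^ (k : ℤ) / 4 := by
    rw [zpow_sub₀ (by norm_num), zpow_sub₀ (by norm_num)]; norm_num; ring
  have e3 : chi η₀ ((k : ℤ) - 1) ξ + chi η₀ (k : ℤ) ξ + chi η₀ ((k : ℤ) + 1) ξ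
      = η₀ (ξ / (2 * 2 ^ (k : ℤ))) - η₀ (ξ / (2 ^ (k : ℤ) / 4)) := by
    unfold chi
    rw [e1, e2, add_sub_cancel_right]; ring
  have e4 : -(p * |p|) - ω ξ = ξ * |ξ| - p * |p| := by
    unfold ω; ring
  rw [e3, e4]
end
end

section
/- Let k ≥ 1 and let g be a Schwartz function on ℝ supported in I_k = {ξ : |ξ| ∈ [2^(k-1), 2^(k+1)]}. Then the maximal function estimate ‖∫_ℝ g(ξ) e^{ixξ} e^{itω(ξ)} dξ‖_{L²_x L^∞_{t∈[-1/2,1/2]}} ≤ C 2^{k/2} ‖g‖_{L²} holds, where ω(ξ) = -ξ|ξ| and C is an absolute constant. -/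
open MeasureTheory

noncomputable section

/-- profile -/
def hprof (w : ℝ) : ℝ := Real.sqrt Real.pi * Real.exp (9/4) * (|w| ^ (-(1/2) : ℝ) * Real.exp (-(1/2) * |w| ^ (1:ℝ)))

lemma hprof_nonneg (w : ℝ) : 0 ≤ hprof w := by unfold hprof; positivity

lemma hprof_measurable : Measurable hprof := by unfold hprof; fun_prop

lemma hprof_integrable : Integrable hprof := by
  unfold hprof
  refine Integrable.const_mul ?_ _
  have h := integrableOn_rpow_mul_exp_neg_mul_rpow (s := -(1/2)) (p := 1) (b := 1/2)
    (by norm_num) (by norm_num) (by norm_num)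
  have h1 : IntegrableOn (fun w : ℝ => |w| ^ (-(1/2) : ℝ) * Real.exp (-(1/2) * |w| ^ (1:ℝ))) (Set.Ioi 0) := by
    refine h.congr_fun (fun w hw => ?_) measurableSet_Ioi
    simp only [abs_of_pos (Set.mem_Ioi.1 hw)]
  have h2 : IntegrableOn (fun w : ℝ => |w| ^ (-(1/2) : ℝ) * Real.exp (-(1/2) * |w| ^ (1:ℝ))) (Set.Iic 0) := by
    have h3 := ((Measure.measurePreserving_neg (volume : Measure ℝ)).integrableOn_comp_preimage
      (Homeomorph.neg ℝ).measurableEmbedding).2 h1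
    rw [integrableOn_Iic_iff_integrableOn_Iio]
    simpa [Function.comp_def] using h3
  rw [← integrableOn_univ, ← Set.Iic_union_Ioi (a := (0:ℝ))]
  exact h2.union h1

lemma prof_aux (s w : ℝ) (hs : 0 < s) (hs2 : s ≤ 2) (hw : 0 < w) :
    (Real.pi / s) ^ (1/2 : ℝ) * Real.exp (-(w^2 / (4 * s^2))) ≤ hprof w := by
  unfold hprof
  rw [abs_of_pos hw, Real.rpow_one, Real.sqrt_eq_rpow]
  obtain ⟨y, hy⟩ : ∃ y, y = w / s := ⟨_, rfl⟩
  have hy0 : 0 < y := by rw [hy]; positivity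
  have e1 : Real.pi / s = Real.pi * (w⁻¹ * y) := by rw [hy]; field_simp
  have e2 : w^2 / (4 * s^2) = y^2/4 := by rw [hy]; field_simp
  have hyw : w / 2 ≤ y := by rw [hy]; gcongr
  rw [e1, e2, Real.mul_rpow (by positivity) (by positivity),
    Real.mul_rpow (by positivity) (by positivity), Real.inv_rpow hw.le, ← Real.rpow_neg hw.le]
  have h1 : y ^ (1/2 : ℝ) ≤ Real.exp (y/2) := by
    have : y ≤ Real.exp y := by linarith [Real.add_one_le_exp y]
    calc y ^ (1/2 : ℝ) ≤ (Real.exp y) ^ (1/2 : ℝ) := by gcongr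
      _ = Real.exp (y/2) := by rw [← Real.exp_mul]; congr 1; ring
  have h2 : y ^ (1/2 : ℝ) * Real.exp (-(y^2/4)) ≤ Real.exp (9/4) * Real.exp (-(1/2) * w) := by
    calc y ^ (1/2 : ℝ) * Real.exp (-(y^2/4)) ≤ Real.exp (y/2) * Real.exp (-(y^2/4)) := by gcongr
      _ ≤ _ := by
        rw [← Real.exp_add, ← Real.exp_add]
        apply Real.exp_le_exp.2
        nlinarith [sq_nonneg (y/2 - 3/2)]
  calc _ = Real.pi ^ (1/2:ℝ) * w ^ (-(1/2):ℝ) * (y ^ (1/2 : ℝ) * Real.exp (-(y^2/4))) := by ring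
    _ ≤ Real.pi ^ (1/2:ℝ) * w ^ (-(1/2):ℝ) * (Real.exp (9/4) * Real.exp (-(1/2) * w)) := by gcongr
    _ = _ := by ring

def phs (x t ξ : ℝ) : ℂ := Complex.exp (Complex.I * ((x * ξ - t * ξ ^ 2 : ℝ) : ℂ))

lemma norm_phs (x t ξ : ℝ) : ‖phs x t ξ‖ = 1 := by
  unfold phs; rw [mul_comm]; exact Complex.norm_exp_ofReal_mul_I _

lemma phs_conj (x t y s ξ : ℝ) : phs x t ξ * (starRingEnd ℂ) (phs y s ξ) = phs (x - y) (t - s) ξ := by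
  unfold phs
  rw [← Complex.exp_conj, ← Complex.exp_add]
  congr 1
  simp only [map_mul, Complex.conj_I, Complex.conj_ofReal]
  push_cast
  ring

def wt (N ξ : ℝ) : ℝ := Real.exp (-(ξ ^ 2 / N ^ 2))

def Ker (N x t : ℝ) : ℂ := ∫ ξ : ℝ, (wt N ξ : ℂ) * phs x t ξ

lemma Ker_bound (N x t : ℝ) (hN : 1 ≤ N) (ht : |t| ≤ 1) (hx : x ≠ 0) :
    ‖Ker N x t‖ ≤ hprof (x / N) := by
  have hN0 : 0 < N := by linarith
  set b : ℂ := ⟨1 / N^2, t⟩ with hb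
  have hbre : 0 < b.re := by simp [hb]; positivity
  have h := fourierIntegral_gaussian hbre (x : ℂ)
  have hK : Ker N x t = ∫ ξ : ℝ, Complex.exp (Complex.I * x * ξ) * Complex.exp (-b * ξ^2) := by
    unfold Ker wt phs
    congr 1; ext ξ
    have hbe : b = ((1/N^2 : ℝ) : ℂ) + t * Complex.I := by
      apply Complex.ext
      · simp only [hb, Complex.add_re, Complex.ofReal_re, Complex.re_ofReal_mul, Complex.I_re]; ring
      · simp only [hb, Complex.add_im, Complex.ofReal_im, Complex.im_ofReal_mul, Complex.I_im]; ring
    rw [hbe, Complex.ofReal_exp, ← Complex.exp_add, ← Complex.exp_add]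
    congr 1
    push_cast
    ring
  have hb0 : b ≠ 0 := by intro h0; rw [h0] at hbre; simp at hbre
  have hs : 0 < ‖b‖ := norm_pos_iff.2 hb0
  have hs2 : ‖b‖ ≤ 2 := by
    refine (Complex.norm_le_abs_re_add_abs_im b).trans ?_
    have : |b.re| ≤ 1 := by
      rw [abs_of_pos hbre]; simp only [hb]
      rw [div_le_one (by positivity)]; nlinarith
    have h2 : |b.im| ≤ 1 := ht
    linarith
  have hw : 0 < |x| / N := by positivity
  have key := prof_aux ‖b‖ (|x|/N) hs hs2 hw
  have e3 : hprof (|x|/N) = hprof (x/N) := by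
    unfold hprof; simp [abs_div]
  rw [e3] at key
  rw [hK, h, norm_mul]
  have e4 : ‖((Real.pi : ℂ) / b) ^ (1/2 : ℂ)‖ = (Real.pi / ‖b‖) ^ (1/2 : ℝ) := by
    have : (1/2 : ℂ) = ((1/2 : ℝ) : ℂ) := by push_cast; rfl
    rw [this, Complex.norm_cpow_real, norm_div, Complex.norm_real, Real.norm_of_nonneg Real.pi_pos.le]
  have e5 : ‖Complex.exp (-(x:ℂ)^2 / (4 * b))‖ = Real.exp (-((|x|/N)^2 / (4 * ‖b‖^2))) := by
    rw [Complex.norm_exp]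
    congr 1
    have : -(x:ℂ)^2 / (4 * b) = ((-(x^2/4) : ℝ) : ℂ) * b⁻¹ := by
      push_cast; field_simp
    rw [this, Complex.re_ofReal_mul, Complex.inv_re, ← Complex.sq_norm]
    have : b.re = 1/N^2 := rfl
    rw [this, div_pow, sq_abs]
    field_simp
  rw [e4, e5]
  exact key

lemma lintegral_hprof (N : ℝ) (hN : 0 < N) :
    ∫⁻ x : ℝ, ENNReal.ofReal (hprof (x / N)) = ENNReal.ofReal (N * ∫ w, hprof w) := by
  rw [← ofReal_integral_eq_lintegral_ofReal]
  · congr 1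
    rw [Measure.integral_comp_div, abs_of_pos hN, smul_eq_mul]
  · exact hprof_integrable.comp_div hN.ne'
  · exact Filter.Eventually.of_forall fun x => hprof_nonneg _

lemma schur (μ : Measure ℝ) [SFinite μ] (hμ : μ ≤ volume) (U : ℝ → ℂ) (hU : Measurable U)
    (K : ℝ → ℝ → ℂ) (H : ℝ → ENNReal) (hH : Measurable H) (hHe : ∀ x, H (-x) = H x)
    (hK : ∀ x y, x ≠ y → ‖K x y‖ₑ ≤ H (x - y)) :
    2 * ∫⁻ x, ∫⁻ y, ‖U x‖ₑ * ‖U y‖ₑ * ‖K x y‖ₑ ∂μ ∂μ ≤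
      2 * ((∫⁻ z, H z) * ∫⁻ x, ‖U x‖ₑ ^ 2 ∂μ) := by
  have amgm : ∀ a b : ENNReal, 2 * (a * b) ≤ a ^ 2 + b ^ 2 := by
    intro a b
    rcases eq_or_ne a ⊤ with rfl | ha
    · simp
    rcases eq_or_ne b ⊤ with rfl | hb
    · simp
    lift a to NNReal using ha
    lift b to NNReal using hb
    rw [← mul_assoc]
    exact_mod_cast two_mul_le_add_sq a b
  have hinner : ∀ x, ∫⁻ y, H (x - y) ∂μ ≤ ∫⁻ z, H z := by
    intro x
    calc _ ≤ ∫⁻ y, H (x - y) := lintegral_mono' hμ le_rfl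
      _ = _ := lintegral_sub_left_eq_self H x
  have hnull : ∀ x, ∀ᵐ y ∂μ, y ≠ x := fun x =>
    (Measure.absolutelyContinuous_of_le hμ).ae_le (Measure.ae_ne volume x)
  have hm : Measurable fun p : ℝ × ℝ => ‖U p.1‖ₑ ^ 2 * H (p.1 - p.2) := by fun_prop
  have hm2 : Measurable fun p : ℝ × ℝ => ‖U p.2‖ₑ ^ 2 * H (p.1 - p.2) := by fun_prop
  have S1 : ∫⁻ x, ∫⁻ y, ‖U x‖ₑ ^ 2 * H (x - y) ∂μ ∂μ ≤ (∫⁻ z, H z) * ∫⁻ x, ‖U x‖ₑ ^ 2 ∂μ := by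
    rw [← lintegral_const_mul _ (by fun_prop)]
    refine lintegral_mono fun x => ?_
    rw [lintegral_const_mul _ (by fun_prop), mul_comm]
    exact mul_le_mul' (hinner x) le_rfl
  have S2 : ∫⁻ x, ∫⁻ y, ‖U y‖ₑ ^ 2 * H (x - y) ∂μ ∂μ ≤ (∫⁻ z, H z) * ∫⁻ x, ‖U x‖ₑ ^ 2 ∂μ := by
    rw [lintegral_lintegral_swap hm2.aemeasurable]
    refine le_trans (le_of_eq ?_) S1
    refine lintegral_congr fun x => lintegral_congr fun y => ?_
    rw [← hHe (x - y), neg_sub]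
  calc 2 * ∫⁻ x, ∫⁻ y, ‖U x‖ₑ * ‖U y‖ₑ * ‖K x y‖ₑ ∂μ ∂μ
      = ∫⁻ x, ∫⁻ y, 2 * (‖U x‖ₑ * ‖U y‖ₑ * ‖K x y‖ₑ) ∂μ ∂μ := by
        rw [← lintegral_const_mul' _ _ (by simp)]
        refine lintegral_congr fun x => ?_
        rw [← lintegral_const_mul' _ _ (by simp)]
    _ ≤ ∫⁻ x, ∫⁻ y, (‖U x‖ₑ ^ 2 * H (x - y) + ‖U y‖ₑ ^ 2 * H (x - y)) ∂μ ∂μ := by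
        refine lintegral_mono fun x => ?_
        refine lintegral_mono_ae ?_
        filter_upwards [hnull x] with y hy
        rw [← mul_assoc, ← add_mul]
        exact mul_le_mul' (amgm _ _) (hK x y hy.symm)
    _ = ∫⁻ x, ∫⁻ y, ‖U x‖ₑ ^ 2 * H (x - y) ∂μ ∂μ + ∫⁻ x, ∫⁻ y, ‖U y‖ₑ ^ 2 * H (x - y) ∂μ ∂μ := by
        rw [← lintegral_add_left hm.lintegral_prod_right']
        refine lintegral_congr fun x => ?_
        rw [lintegral_add_left (by fun_prop)]
    _ ≤ _ := by rw [two_mul]; exact add_le_add S1 S2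

lemma continuous_wt (N : ℝ) : Continuous (wt N) := by unfold wt; fun_prop

lemma wt_pos (N ξ : ℝ) : 0 < wt N ξ := Real.exp_pos _

lemma wt_integrable (N : ℝ) (hN : 0 < N) : Integrable (wt N) := by
  have := integrable_exp_neg_mul_sq (b := 1 / N^2) (by positivity)
  refine this.congr (Filter.Eventually.of_forall fun ξ => ?_)
  simp only [wt]; congr 1; ring

lemma phs_meas (τ : ℝ → ℝ) (hτ : Measurable τ) :
    Measurable fun p : ℝ × ℝ => phs p.1 (τ p.1) p.2 := by
  unfold phs; fun_prop

lemma core_fin (N A : ℝ) (hN : 1 ≤ N) (hA : 0 < A) (hAh : ∫ w, hprof w ≤ A)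
    (τ : ℝ → ℝ) (hτ : Measurable τ) (hτb : ∀ x, |τ x| ≤ 1/2)
    (G : ℝ → ℂ) (hG : Measurable G) (hGi : Integrable G) (hG2 : Integrable fun ξ => ‖G ξ‖ ^ 2)
    (hGs : ∀ ξ, G ξ ≠ 0 → |ξ| ≤ 2 * N)
    (μ : Measure ℝ) [IsFiniteMeasure μ] (hμ : μ ≤ volume) :
    ∫ x, ‖∫ ξ, G ξ * phs x (τ x) ξ‖ ^ 2 ∂μ ≤ Real.exp 4 * (N * A) * ∫ ξ, ‖G ξ‖ ^ 2 := by
  have hN0 : 0 < N := by linarith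
  set U : ℝ → ℂ := fun x => ∫ ξ, G ξ * phs x (τ x) ξ with hUdef
  set M : ℝ := ∫ ξ, ‖G ξ‖ with hM
  have hpm := phs_meas τ hτ
  have hUm : Measurable U := by
    refine (StronglyMeasurable.integral_prod_right (f := fun x ξ => G ξ * phs x (τ x) ξ) ?_).measurable
    exact ((hG.comp measurable_snd).mul hpm).stronglyMeasurable
  have hUb : ∀ x, ‖U x‖ ≤ M := by
    intro x
    refine (norm_integral_le_integral_norm _).trans (le_of_eq ?_)
    simp [norm_phs, hM]
  have hM0 : 0 ≤ M := (norm_nonneg _).trans (hUb 0)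
  set c : ℝ → ℂ := fun x => (starRingEnd ℂ) (U x) with hc
  have hcm : Measurable c := Complex.continuous_conj.measurable.comp hUm
  have hcn : ∀ x, ‖c x‖ = ‖U x‖ := fun x => RCLike.norm_conj _
  set F : ℝ → ℂ := fun ξ => ∫ x, c x * phs x (τ x) ξ ∂μ with hF
  have hFm : Measurable F := by
    refine (StronglyMeasurable.integral_prod_left (f := fun x ξ => c x * phs x (τ x) ξ) ?_).measurable
    exact ((hcm.comp measurable_fst).mul hpm).stronglyMeasurable
  set L : ℝ := μ.real Set.univ * M with hL
  have hFb : ∀ ξ, ‖F ξ‖ ≤ L := by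
    intro ξ
    have := norm_integral_le_of_norm_le_const (μ := μ) (f := fun x => c x * phs x (τ x) ξ) (C := M)
      (Filter.Eventually.of_forall fun x => by
        rw [norm_mul, norm_phs, mul_one, hcn]; exact hUb x)
    rw [hL, mul_comm]; exact this
  have hL0 : 0 ≤ L := (norm_nonneg _).trans (hFb 0)
  set Q : ℝ := ∫ x, ‖U x‖ ^ 2 ∂μ with hQ
  set B : ℝ := ∫ ξ, wt N ξ * ‖F ξ‖ ^ 2 with hB
  have hU2i : Integrable (fun x => ‖U x‖ ^ 2) μ := by
    refine Integrable.of_bound (by fun_prop) (M ^ 2) (Filter.Eventually.of_forall fun x => ?_)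
    rw [Real.norm_of_nonneg (by positivity)]
    gcongr; exact hUb x
  have hwF : Integrable fun ξ => wt N ξ * ‖F ξ‖ ^ 2 := by
    refine (wt_integrable N hN0).mul_bdd (c := L ^ 2) (by fun_prop) (Filter.Eventually.of_forall fun ξ => ?_)
    rw [Real.norm_of_nonneg (by positivity)]
    gcongr; exact hFb ξ
  -- duality
  have ha : (Q : ℂ) = ∫ ξ, G ξ * F ξ := by
    have h1 : (Q : ℂ) = ∫ x, ∫ ξ, c x * (G ξ * phs x (τ x) ξ) ∂volume ∂μ := by
      rw [hQ, ← integral_complex_ofReal]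
      congr 1; ext x
      rw [integral_const_mul]
      change _ = (starRingEnd ℂ) (U x) * U x
      rw [mul_comm, Complex.mul_conj, Complex.normSq_eq_norm_sq]
    rw [h1, integral_integral_swap]
    · congr 1; ext ξ
      rw [hF, ← integral_const_mul]
      congr 1; ext x; ring
    · have hci : Integrable c μ := by
        refine Integrable.of_bound hcm.aestronglyMeasurable M (Filter.Eventually.of_forall fun x => ?_)
        rw [hcn]; exact hUb x
      have := (hci.mul_prod hGi).mul_bdd (c := 1) hpm.aestronglyMeasurable
        (Filter.Eventually.of_forall fun p => by rw [norm_phs])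
      refine this.congr (Filter.Eventually.of_forall fun p => ?_)
      simp only [Function.uncurry]; ring
  set lam : ℝ := N * A with hlam
  have hlam0 : 0 < lam := by positivity
  have hb : Q ≤ lam / 2 * Real.exp 4 * (∫ ξ, ‖G ξ‖ ^ 2) + 1 / (2 * lam) * B := by
    have hQ0 : 0 ≤ Q := integral_nonneg fun x => by positivity
    calc Q = ‖(Q : ℂ)‖ := by rw [Complex.norm_real, Real.norm_of_nonneg hQ0]
      _ = ‖∫ ξ, G ξ * F ξ‖ := by rw [ha]
      _ ≤ ∫ ξ, (lam / 2 * Real.exp 4 * ‖G ξ‖ ^ 2 + 1 / (2 * lam) * (wt N ξ * ‖F ξ‖ ^ 2)) := by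
        refine norm_integral_le_of_norm_le ((hG2.const_mul _).add (hwF.const_mul _))
          (Filter.Eventually.of_forall fun ξ => ?_)
        rw [norm_mul]
        have hw := wt_pos N ξ
        by_cases h0 : G ξ = 0
        · rw [h0, norm_zero, zero_mul]; positivity
        have hξ := hGs ξ h0
        have hwe : 1 ≤ Real.exp 4 * wt N ξ := by
          unfold wt
          rw [← Real.exp_add]
          apply Real.one_le_exp
          have : ξ ^ 2 / N ^ 2 ≤ 4 := by
            rw [div_le_iff₀ (by positivity)]
            have := pow_le_pow_left₀ (abs_nonneg _) hξ 2
            rw [sq_abs] at this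
            linarith
          linarith
        set a := ‖G ξ‖
        set f := ‖F ξ‖
        set w := wt N ξ
        have e : lam / 2 * Real.exp 4 * a ^ 2 + 1 / (2 * lam) * (w * f ^ 2) - a * f =
          1 / (2 * lam * w) * ((lam * a - w * f)^2 + lam^2 * a^2 * (Real.exp 4 * w - 1)) := by
          field_simp; ring
        have : 0 ≤ 1 / (2 * lam * w) * ((lam * a - w * f)^2 + lam^2 * a^2 * (Real.exp 4 * w - 1)) := by
          have : 0 ≤ Real.exp 4 * w - 1 := by linarith
          positivity
        linarith
      _ = _ := by
        rw [integral_add (hG2.const_mul _) (hwF.const_mul _), integral_const_mul, integral_const_mul]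
  -- TT*
  have hBK : (B : ℂ) = ∫ p, c p.1 * U p.2 * Ker N (p.1 - p.2) (τ p.1 - τ p.2) ∂(μ.prod μ) := by
    have h1 : (B : ℂ) = ∫ ξ, ∫ p, (wt N ξ : ℂ) * ((c p.1 * phs p.1 (τ p.1) ξ) *
        (U p.2 * (starRingEnd ℂ) (phs p.2 (τ p.2) ξ))) ∂(μ.prod μ) := by
      rw [hB, ← integral_complex_ofReal]
      congr 1; ext ξ
      rw [integral_const_mul, integral_prod_mul (fun x => c x * phs x (τ x) ξ)
        (fun y => U y * (starRingEnd ℂ) (phs y (τ y) ξ))]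
      have : ∫ y, U y * (starRingEnd ℂ) (phs y (τ y) ξ) ∂μ = (starRingEnd ℂ) (F ξ) := by
        rw [hF, ← integral_conj]
        congr 1; ext y
        simp [hc]
      rw [this]
      push_cast
      rw [← Complex.ofReal_pow, ← Complex.normSq_eq_norm_sq, ← Complex.mul_conj]
    rw [h1, integral_integral_swap]
    · congr 1; ext p
      unfold Ker
      rw [← integral_const_mul]
      congr 1; ext ξ
      rw [← phs_conj]; ring
    · have hbd : Integrable (fun q : ℝ × (ℝ × ℝ) => (wt N q.1 : ℂ) * (1 : ℂ)) (volume.prod (μ.prod μ)) :=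
        Integrable.mul_prod (f := fun ξ => (wt N ξ : ℂ)) (g := fun _ => (1:ℂ))
          (wt_integrable N hN0).ofReal (integrable_const _)
      have hp1 : Measurable fun q : ℝ × (ℝ × ℝ) => phs q.2.1 (τ q.2.1) q.1 :=
        hpm.comp (measurable_snd.fst.prodMk measurable_fst)
      have hp2 : Measurable fun q : ℝ × (ℝ × ℝ) => (starRingEnd ℂ) (phs q.2.2 (τ q.2.2) q.1) :=
        Complex.continuous_conj.measurable.comp
          (hpm.comp (measurable_snd.snd.prodMk measurable_fst))
      have := hbd.mul_bdd (c := M * M) (g := fun q : ℝ × (ℝ × ℝ) => (c q.2.1 * phs q.2.1 (τ q.2.1) q.1) *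
        (U q.2.2 * (starRingEnd ℂ) (phs q.2.2 (τ q.2.2) q.1)))
        (((hcm.comp measurable_snd.fst).mul hp1).mul
          ((hUm.comp measurable_snd.snd).mul hp2)).aestronglyMeasurable
        (Filter.Eventually.of_forall fun q => by
          rw [norm_mul, norm_mul, norm_mul, hcn, RCLike.norm_conj, norm_phs, norm_phs, mul_one, mul_one]
          exact mul_le_mul (hUb _) (hUb _) (norm_nonneg _) hM0)
      refine this.congr (Filter.Eventually.of_forall fun q => ?_)
      simp only [Function.uncurry]; ring
  have hBQ : B ≤ lam * Q := by
    have hQ0 : 0 ≤ Q := integral_nonneg fun x => by positivity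
    have hB0 : 0 ≤ B := integral_nonneg fun ξ => by have := wt_pos N ξ; positivity
    have hS := schur μ hμ U hUm (fun x y => Ker N (x - y) (τ x - τ y))
      (fun z => ENNReal.ofReal (hprof (z / N))) (by have := hprof_measurable; fun_prop)
      (fun x => by unfold hprof; simp [abs_div])
      (fun x y hxy => by
        rw [← ofReal_norm]
        apply ENNReal.ofReal_le_ofReal
        refine Ker_bound N _ _ hN ?_ (sub_ne_zero.2 hxy)
        have := abs_sub (τ x) (τ y)
        linarith [hτb x, hτb y])
    rw [ENNReal.mul_le_mul_iff_right (by simp) (by simp), lintegral_hprof N hN0] at hS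
    have hQe : ∫⁻ x, ‖U x‖ₑ ^ 2 ∂μ = ENNReal.ofReal Q := by
      rw [hQ, ofReal_integral_eq_lintegral_ofReal hU2i (Filter.Eventually.of_forall fun x => by positivity)]
      refine lintegral_congr fun x => ?_
      rw [ENNReal.ofReal_pow (norm_nonneg _), ofReal_norm]
    rw [hQe] at hS
    have h2 : ENNReal.ofReal B ≤ ENNReal.ofReal (lam * Q) := by
      calc ENNReal.ofReal B = ‖(B : ℂ)‖ₑ := by
            rw [← ofReal_norm, Complex.norm_real, Real.norm_of_nonneg hB0]
        _ ≤ ∫⁻ p, ‖c p.1 * U p.2 * Ker N (p.1 - p.2) (τ p.1 - τ p.2)‖ₑ ∂(μ.prod μ) := by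
            rw [hBK]; exact enorm_integral_le_lintegral_enorm _
        _ ≤ ∫⁻ x, ∫⁻ y, ‖c x * U y * Ker N (x - y) (τ x - τ y)‖ₑ ∂μ ∂μ :=
            lintegral_prod_le _
        _ = ∫⁻ x, ∫⁻ y, ‖U x‖ₑ * ‖U y‖ₑ * ‖Ker N (x - y) (τ x - τ y)‖ₑ ∂μ ∂μ := by
            refine lintegral_congr fun x => lintegral_congr fun y => ?_
            rw [enorm_mul, enorm_mul]
            congr 2
            rw [← ofReal_norm, hcn, ofReal_norm]
        _ ≤ _ := hS
        _ ≤ _ := by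
            rw [ENNReal.ofReal_mul hlam0.le]
            gcongr
            rw [hlam]
            gcongr
    exact (ENNReal.ofReal_le_ofReal_iff (by positivity)).1 h2
  have : 1 / (2 * lam) * B ≤ Q / 2 := by
    calc 1 / (2 * lam) * B ≤ 1 / (2 * lam) * (lam * Q) := by gcongr
      _ = Q / 2 := by field_simp
  nlinarith

lemma core_s12 (N A : ℝ) (hN : 1 ≤ N) (hA : 0 < A) (hAh : ∫ w, hprof w ≤ A)
    (τ : ℝ → ℝ) (hτ : Measurable τ) (hτb : ∀ x, |τ x| ≤ 1/2)
    (G : ℝ → ℂ) (hG : Measurable G) (hGi : Integrable G) (hG2 : Integrable fun ξ => ‖G ξ‖ ^ 2)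
    (hGs : ∀ ξ, G ξ ≠ 0 → |ξ| ≤ 2 * N) :
    ∫⁻ x, ‖∫ ξ, G ξ * phs x (τ x) ξ‖ₑ ^ 2 ≤
      ENNReal.ofReal (Real.exp 4 * (N * A) * ∫ ξ, ‖G ξ‖ ^ 2) := by
  have hUm : Measurable fun x => ∫ ξ, G ξ * phs x (τ x) ξ := by
    refine (StronglyMeasurable.integral_prod_right (f := fun x ξ => G ξ * phs x (τ x) ξ) ?_).measurable
    exact ((hG.comp measurable_snd).mul (phs_meas τ hτ)).stronglyMeasurable
  have hcov : AECover (volume : Measure ℝ) Filter.atTop fun n : ℕ => Set.Icc (-(n:ℝ)) n :=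
    aecover_Icc (Filter.tendsto_neg_atTop_atBot.comp tendsto_natCast_atTop_atTop)
      tendsto_natCast_atTop_atTop
  rw [← hcov.iSup_lintegral_eq_of_countably_generated (hUm.enorm.pow_const 2).aemeasurable]
  refine iSup_le fun n => ?_
  have h := core_fin N A hN hA hAh τ hτ hτb G hG hGi hG2 hGs (volume.restrict (Set.Icc (-(n:ℝ)) n))
    Measure.restrict_le_self
  refine le_trans (le_of_eq ?_) (ENNReal.ofReal_le_ofReal h)
  rw [ofReal_integral_eq_lintegral_ofReal _ (Filter.Eventually.of_forall fun x => by positivity)]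
  · refine lintegral_congr fun x => ?_
    rw [ENNReal.ofReal_pow (norm_nonneg _), ofReal_norm]
  · refine Integrable.of_bound (hUm.norm.pow_const 2).aestronglyMeasurable ((∫ ξ, ‖G ξ‖) ^ 2) (Filter.Eventually.of_forall fun x => ?_)
    rw [Real.norm_of_nonneg (by positivity)]
    gcongr
    refine (norm_integral_le_integral_norm _).trans (le_of_eq ?_)
    simp [norm_phs]

def uev (g : ℝ → ℂ) (x t : ℝ) : ℂ :=
  ∫ ξ : ℝ, g ξ * Complex.exp (Complex.I * ((x * ξ + t * ω ξ : ℝ) : ℂ))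

lemma uev_continuous (g : ℝ → ℂ) (hg : Integrable g) :
    Continuous fun p : ℝ × ℝ => uev g p.1 p.2 := by
  unfold uev
  refine continuous_of_dominated (bound := fun ξ => ‖g ξ‖) ?_ ?_ hg.norm ?_
  · intro p
    refine hg.aestronglyMeasurable.mul (Continuous.aestronglyMeasurable ?_)
    unfold ω; fun_prop
  · intro p
    refine Filter.Eventually.of_forall fun ξ => ?_
    rw [norm_mul, mul_comm Complex.I, Complex.norm_exp_ofReal_mul_I, mul_one]
  · refine Filter.Eventually.of_forall fun ξ => ?_
    fun_prop

lemma uev_split (g : ℝ → ℂ) (hg : Integrable g) (x t : ℝ) :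
    uev g x t = (∫ ξ, (Set.Ioi (0:ℝ)).indicator g ξ * phs x t ξ) +
      ∫ ξ, (Set.Iic (0:ℝ)).indicator g ξ * phs x (-t) ξ := by
  have hi : ∀ (s : Set ℝ) (_ : MeasurableSet s) (t : ℝ), Integrable fun ξ => s.indicator g ξ * phs x t ξ := by
    intro s hs t
    refine (hg.indicator hs).mul_bdd (c := 1) ?_ (Filter.Eventually.of_forall fun ξ => by rw [norm_phs])
    refine Continuous.aestronglyMeasurable ?_
    unfold phs; fun_prop
  rw [← integral_add (hi _ measurableSet_Ioi _) (hi _ measurableSet_Iic _)]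
  unfold uev
  congr 1; ext ξ
  rcases le_or_gt ξ 0 with h | h
  · rw [Set.indicator_of_notMem (by simpa using h), Set.indicator_of_mem (by simpa using h)]
    simp only [zero_mul, zero_add, phs, ω, abs_of_nonpos h]
    congr 4; ring
  · rw [Set.indicator_of_mem (by simpa using h), Set.indicator_of_notMem (by simpa using h)]
    simp only [zero_mul, add_zero, phs, ω, abs_of_pos h]
    congr 4; ring

lemma sel_bound (N A : ℝ) (hN : 1 ≤ N) (hA : 0 < A) (hAh : ∫ w, hprof w ≤ A)
    (τ : ℝ → ℝ) (hτ : Measurable τ) (hτb : ∀ x, |τ x| ≤ 1/2)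
    (g : ℝ → ℂ) (hG : Measurable g) (hGi : Integrable g) (hG2 : Integrable fun ξ => ‖g ξ‖ ^ 2)
    (hGs : ∀ ξ, g ξ ≠ 0 → |ξ| ≤ 2 * N) :
    ∫⁻ x, ‖uev g x (τ x)‖ₑ ^ 2 ≤
      ENNReal.ofReal (4 * (Real.exp 4 * (N * A) * ∫ ξ, ‖g ξ‖ ^ 2)) := by
  have hc : ∀ (s : Set ℝ) (_ : MeasurableSet s) (σ : ℝ → ℝ) (_ : Measurable σ) (_ : ∀ x, |σ x| ≤ 1/2),
      ∫⁻ x, ‖∫ ξ, s.indicator g ξ * phs x (σ x) ξ‖ₑ ^ 2 ≤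
      ENNReal.ofReal (Real.exp 4 * (N * A) * ∫ ξ, ‖g ξ‖ ^ 2) := by
    intro s hs σ hσ hσb
    have hle : ∀ ξ, ‖s.indicator g ξ‖ ^ 2 ≤ ‖g ξ‖ ^ 2 := fun ξ => by
      gcongr; exact norm_indicator_le_norm_self _ _
    have hi2 : Integrable fun ξ => ‖s.indicator g ξ‖ ^ 2 := by
      refine hG2.mono' (((hG.indicator hs).norm.pow_const 2).aestronglyMeasurable)
        (Filter.Eventually.of_forall fun ξ => ?_)
      rw [Real.norm_of_nonneg (by positivity)]; exact hle ξ
    refine (core_s12 N A hN hA hAh σ hσ hσb (s.indicator g) (hG.indicator hs) (hGi.indicator hs) hi2 ?_).trans ?_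
    · intro ξ hξ
      refine hGs ξ fun h0 => hξ ?_
      by_cases hm : ξ ∈ s <;> simp [hm, h0]
    · apply ENNReal.ofReal_le_ofReal
      have := integral_mono hi2 hG2 hle
      have : 0 ≤ N * A := by positivity
      gcongr
  have h1 := hc (Set.Ioi 0) measurableSet_Ioi τ hτ hτb
  have h2 := hc (Set.Iic 0) measurableSet_Iic (fun x => -τ x) hτ.neg (fun x => by rw [abs_neg]; exact hτb x)
  have hmeas : Measurable fun x => ∫ ξ, (Set.Ioi (0:ℝ)).indicator g ξ * phs x (τ x) ξ := by
    refine (StronglyMeasurable.integral_prod_right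
      (f := fun x ξ => (Set.Ioi (0:ℝ)).indicator g ξ * phs x (τ x) ξ) ?_).measurable
    exact (((hG.indicator measurableSet_Ioi).comp measurable_snd).mul (phs_meas τ hτ)).stronglyMeasurable
  have hpt : ∀ a b : ℂ, ‖a + b‖ₑ ^ 2 ≤ 2 * ‖a‖ₑ ^ 2 + 2 * ‖b‖ₑ ^ 2 := by
    intro a b
    have h : ‖a + b‖ ^ 2 ≤ 2 * ‖a‖ ^ 2 + 2 * ‖b‖ ^ 2 := by
      have := norm_add_le a b
      have := pow_le_pow_left₀ (norm_nonneg _) this 2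
      nlinarith [sq_nonneg (‖a‖ - ‖b‖)]
    have := ENNReal.ofReal_le_ofReal h
    rw [ENNReal.ofReal_add (by positivity) (by positivity), ENNReal.ofReal_mul (by norm_num),
      ENNReal.ofReal_mul (by norm_num), ENNReal.ofReal_pow (norm_nonneg _),
      ENNReal.ofReal_pow (norm_nonneg _), ENNReal.ofReal_pow (norm_nonneg _)] at this
    simpa using this
  have hI : 0 ≤ Real.exp 4 * (N * A) * ∫ ξ, ‖g ξ‖ ^ 2 := by
    have : 0 ≤ ∫ ξ, ‖g ξ‖ ^ 2 := integral_nonneg fun ξ => by positivity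
    have : 0 ≤ N * A := by positivity
    positivity
  calc ∫⁻ x, ‖uev g x (τ x)‖ₑ ^ 2
      ≤ ∫⁻ x, (2 * ‖∫ ξ, (Set.Ioi (0:ℝ)).indicator g ξ * phs x (τ x) ξ‖ₑ ^ 2 +
        2 * ‖∫ ξ, (Set.Iic (0:ℝ)).indicator g ξ * phs x (-τ x) ξ‖ₑ ^ 2) := by
        refine lintegral_mono fun x => ?_
        rw [uev_split g hGi]; exact hpt _ _
    _ = 2 * (∫⁻ x, ‖∫ ξ, (Set.Ioi (0:ℝ)).indicator g ξ * phs x (τ x) ξ‖ₑ ^ 2) +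
        2 * ∫⁻ x, ‖∫ ξ, (Set.Iic (0:ℝ)).indicator g ξ * phs x (-τ x) ξ‖ₑ ^ 2 := by
        rw [lintegral_add_left ((hmeas.enorm.pow_const 2).const_mul 2),
          lintegral_const_mul' _ _ (by simp), lintegral_const_mul' _ _ (by simp)]
    _ ≤ 2 * ENNReal.ofReal (Real.exp 4 * (N * A) * ∫ ξ, ‖g ξ‖ ^ 2) +
        2 * ENNReal.ofReal (Real.exp 4 * (N * A) * ∫ ξ, ‖g ξ‖ ^ 2) := by gcongr
    _ = _ := by
        rw [ENNReal.ofReal_mul (p := 4) (by norm_num), ← add_mul]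
        congr 1
        norm_num

open Classical in
/-- selected time -/
def selT (g : ℝ → ℂ) (t : ℕ → ℝ) : ℕ → ℝ → ℝ
  | 0, _ => t 0
  | n + 1, x => if ‖uev g x (selT g t n x)‖ ≤ ‖uev g x (t (n+1))‖ then t (n+1) else selT g t n x

lemma selT_meas (g : ℝ → ℂ) (hg : Integrable g) (t : ℕ → ℝ) (n : ℕ) : Measurable (selT g t n) := by
  have hu := (uev_continuous g hg).measurable
  induction n with
  | zero => exact measurable_const
  | succ n ih =>
    refine Measurable.ite (measurableSet_le ?_ ?_) measurable_const ih
    · exact (hu.comp (measurable_id.prodMk ih)).norm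
    · exact (hu.comp (measurable_id.prodMk measurable_const)).norm

lemma selT_bound (g : ℝ → ℂ) (t : ℕ → ℝ) (ht : ∀ n, |t n| ≤ 1/2) (n : ℕ) (x : ℝ) :
    |selT g t n x| ≤ 1/2 := by
  induction n with
  | zero => exact ht 0
  | succ n ih =>
    rw [selT]; split_ifs
    · exact ht _
    · exact ih

lemma selT_mono (g : ℝ → ℂ) (t : ℕ → ℝ) (x : ℝ) :
    Monotone fun n => ‖uev g x (selT g t n x)‖ := by
  refine monotone_nat_of_le_succ fun n => ?_
  rw [selT]; split_ifs with h
  · exact h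
  · exact le_rfl

lemma selT_ge (g : ℝ → ℂ) (t : ℕ → ℝ) (x : ℝ) (n : ℕ) :
    ‖uev g x (t n)‖ ≤ ‖uev g x (selT g t n x)‖ := by
  cases n with
  | zero => exact le_rfl
  | succ n =>
    rw [selT]; split_ifs with h
    · exact le_rfl
    · exact (not_le.1 h).le

lemma max_bound (N A : ℝ) (hN : 1 ≤ N) (hA : 0 < A) (hAh : ∫ w, hprof w ≤ A)
    (g : ℝ → ℂ) (hG : Measurable g) (hGi : Integrable g) (hG2 : Integrable fun ξ => ‖g ξ‖ ^ 2)
    (hGs : ∀ ξ, g ξ ≠ 0 → |ξ| ≤ 2 * N) :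
    ∫⁻ x, (eLpNorm (uev g x) ⊤ (volume.restrict (Set.Icc (-(1 : ℝ)/2) (1/2)))) ^ 2 ≤
      ENNReal.ofReal (4 * (Real.exp 4 * (N * A) * ∫ ξ, ‖g ξ‖ ^ 2)) := by
  have : Nonempty (Set.Icc (-(1 : ℝ)/2) (1/2)) := ⟨⟨0, by norm_num, by norm_num⟩⟩
  set d := TopologicalSpace.denseSeq (Set.Icc (-(1 : ℝ)/2) (1/2)) with hd
  have hdd : DenseRange d := TopologicalSpace.denseRange_denseSeq _
  set t : ℕ → ℝ := fun n => (d n : ℝ) with ht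
  have htb : ∀ n, |t n| ≤ 1/2 := fun n => by
    have := (d n).2
    rw [abs_le]; exact ⟨by have := this.1; simp only [ht]; linarith, this.2⟩
  have hcont := uev_continuous g hGi
  have hpt : ∀ x, (eLpNorm (uev g x) ⊤ (volume.restrict (Set.Icc (-(1 : ℝ)/2) (1/2)))) ^ 2 ≤
      ⨆ n, ‖uev g x (selT g t n x)‖ₑ ^ 2 := by
    intro x
    have hc : Continuous fun s : Set.Icc (-(1 : ℝ)/2) (1/2) => ‖uev g x s‖ₑ ^ 2 := by
      have : Continuous fun s : Set.Icc (-(1 : ℝ)/2) (1/2) => uev g x s :=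
        hcont.comp (continuous_const.prodMk continuous_subtype_val)
      exact (ENNReal.continuous_pow 2).comp this.enorm
    have hall : ∀ s : Set.Icc (-(1 : ℝ)/2) (1/2), ‖uev g x s‖ₑ ^ 2 ≤
        ⨆ n, ‖uev g x (selT g t n x)‖ₑ ^ 2 := by
      intro s
      refine hdd.induction_on s (isClosed_le hc continuous_const) fun n => ?_
      refine le_trans ?_ (le_iSup _ n)
      gcongr
      exact enorm_le_iff_norm_le.2 (selT_ge g t x n)
    set S := ⨆ n, ‖uev g x (selT g t n x)‖ₑ ^ 2
    have hS : (S ^ (1/2 : ℝ)) ^ 2 = S := by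
      rw [← ENNReal.rpow_natCast, ← ENNReal.rpow_mul]; norm_num
    rw [← hS]
    gcongr
    rw [eLpNorm_exponent_top]
    refine eLpNormEssSup_le_of_ae_enorm_bound ?_
    refine (ae_restrict_iff' measurableSet_Icc).2 (Filter.Eventually.of_forall fun s hs => ?_)
    have := hall ⟨s, hs⟩
    have h3 := ENNReal.rpow_le_rpow this (by norm_num : (0:ℝ) ≤ 1/2)
    refine le_trans (le_of_eq ?_) h3
    rw [← ENNReal.rpow_natCast, ← ENNReal.rpow_mul]; norm_num
  refine (lintegral_mono hpt).trans ?_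
  rw [lintegral_iSup]
  · refine iSup_le fun n => ?_
    exact sel_bound N A hN hA hAh _ (selT_meas g hGi t n) (selT_bound g t htb n) g hG hGi hG2 hGs
  · intro n
    exact (hcont.measurable.comp (measurable_id.prodMk (selT_meas g hGi t n))).enorm.pow_const 2
  · intro m n hmn x
    dsimp only
    gcongr
    exact enorm_le_iff_norm_le.2 (selT_mono g t x hmn)

theorem maximal_function_estimate :
    ∃ C : ℝ, 0 < C ∧ ∀ (k : ℤ), 1 ≤ k → ∀ g : SchwartzMap ℝ ℂ,
      Function.support (⇑g) ⊆ Idy k →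
      (eLpNorm (fun x : ℝ =>
          (eLpNorm (fun t : ℝ =>
              ∫ ξ : ℝ, g ξ * Complex.exp (Complex.I * ((x * ξ + t * ω ξ : ℝ) : ℂ)))
            ⊤ (volume.restrict (Set.Icc (-(1 : ℝ)/2) (1/2)))).toReal)
        2 volume).toReal ≤
        C * (2 : ℝ) ^ ((k : ℝ) / 2) * (eLpNorm (⇑g) 2 volume).toReal := by
  have hA0 : 0 ≤ ∫ w, hprof w := integral_nonneg hprof_nonneg
  obtain ⟨A, hAdef⟩ : ∃ A, A = (∫ w, hprof w) + 1 := ⟨_, rfl⟩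
  have hA : 0 < A := by linarith
  refine ⟨Real.sqrt (4 * Real.exp 4 * A), by positivity, ?_⟩
  intro k hk g hg
  have hgm := g.memLp 2 volume
  have hg2 : Integrable fun ξ => ‖g ξ‖ ^ 2 := hgm.integrable_norm_pow (p := 2) (by norm_num)
  have hN : (1:ℝ) ≤ (2:ℝ) ^ k := one_le_zpow₀ (by norm_num) (by linarith)
  have hs : ∀ ξ, g ξ ≠ 0 → |ξ| ≤ 2 * (2:ℝ) ^ k := by
    intro ξ h
    have := (hg h).2
    rwa [zpow_add_one₀ (by norm_num), mul_comm] at this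
  have hmax := max_bound ((2:ℝ) ^ k) A hN hA (by linarith) g g.continuous.measurable g.integrable hg2 hs
  obtain ⟨J, hJ⟩ : ∃ J, J = ∫ ξ, ‖g ξ‖ ^ 2 := ⟨_, rfl⟩
  rw [← hJ] at hmax
  have hJ0 : 0 ≤ J := by rw [hJ]; exact integral_nonneg fun ξ => by positivity
  have hgn : (eLpNorm (⇑g) 2 volume).toReal = Real.sqrt J := by
    rw [hgm.eLpNorm_eq_integral_rpow_norm (by norm_num) (by norm_num), ENNReal.toReal_ofReal (by positivity),
      Real.sqrt_eq_rpow, hJ]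
    norm_num
  rw [hgn]
  have hk2 : (2:ℝ) ^ ((k:ℝ)/2) = Real.sqrt ((2:ℝ) ^ k) := by
    rw [Real.sqrt_eq_rpow, ← Real.rpow_intCast, ← Real.rpow_mul (by norm_num)]
    congr 1; ring
  rw [hk2, ← Real.sqrt_mul (by positivity), ← Real.sqrt_mul (by positivity)]
  refine ENNReal.toReal_le_of_le_ofReal (by positivity) ?_
  rw [eLpNorm_eq_lintegral_rpow_enorm_toReal (by norm_num) (by norm_num), Real.sqrt_eq_rpow,
    ← ENNReal.ofReal_rpow_of_nonneg (by positivity) (by norm_num)]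
  simp only [ENNReal.toReal_ofNat]
  gcongr
  refine le_trans (lintegral_mono fun x => ?_) (hmax.trans (le_of_eq ?_))
  · rw [← ENNReal.rpow_natCast]
    rw [Nat.cast_ofNat]
    gcongr
    rw [Real.enorm_of_nonneg ENNReal.toReal_nonneg]
    exact ENNReal.ofReal_toReal_le
  · congr 1; ring
end
end
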